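/- arXiv:2503.18232 — 3 statements merged into one kernel-verified Lean document; each statement's English description precedes it below -/
import Mathlib

section
/- Let n ≥ 2 and let Ω ⊆ ℝⁿ be a bounded open set whose boundary ∂Ω is an Ahlfors regular set and satisfies ℋ^{n−1}(∂Ω ∖ ∂*Ω) = 0; set σ := ℋ^{n−1} restricted to ∂Ω. Fix κ > 0, p ∈ (1,∞), and let p′ be the conjugate exponent (1/p + 1/p′ = 1). Let u be harmonic in Ω with N_κ u ∈ L^p(∂Ω,σ), and let w : Ω → ℝ be continuous and subharmonic with N_κ w ∈ L^p(∂Ω,σ), such that for σ-a.e. x ∈ ∂Ω the κ-nontangential traces of u and of w at x exist and are equal. Fix x₀ ∈ Ω and suppose there exists a function G : Ω ∖ {x₀} → ℝ (a Green function for the Laplacian in Ω with pole x₀) with the following properties: G is C^∞ on Ω ∖ {x₀}; G > 0 on Ω ∖ {x₀}; G is locally integrable on Ω and ∫_Ω G·Δφ dℒⁿ = −φ(x₀) for every φ ∈ C_c^∞(Ω); the κ-nontangential trace of G equals 0 at σ-a.e. point of ∂Ω; and there exist λ > 1, κ̃ ≥ κ, ε₀ ∈ (0, dist(x₀,∂Ω)/4)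 and A < ∞ such that for every ε ∈ (0,ε₀) one has ‖N^{λε}_{κ̃}(∇G)‖_{L^{p′}(∂Ω,σ)} ≤ A and N^{ε}_{κ}G ≤ ε · N^{λε}_{κ̃}(∇G) at σ-a.e. point of ∂Ω. Then w(x₀) ≤ u(x₀). -/
open MeasureTheory Metric Set Filter
open scoped ENNReal NNReal Topology

noncomputable section

abbrev Euc (n : ℕ) : Type := EuclideanSpace ℝ (Fin n)

variable {n : ℕ}

/-- The nontangential approach region `Γ_κ(x)` to `∂Ω` from within `Ω`. -/
def ntRegion (Ω : Set (Euc n)) (κ : ℝ) (x : Euc n) : Set (Euc n) :=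
  {y | y ∈ Ω ∧ dist x y < (1 + κ) * infDist y (frontier Ω)}

/-- The one-sided collar neighborhood `O_ε` of `∂Ω`. -/
def collar (Ω : Set (Euc n)) (ε : ℝ) : Set (Euc n) :=
  {y | y ∈ Ω ∧ infDist y (frontier Ω) < ε}

/-- Nontangential maximal function of `u` restricted to a set `S` (truncated version). -/
def ntMaxOn {E : Type*} [NormedAddCommGroup E] (Ω S : Set (Euc n)) (κ : ℝ)
    (u : Euc n → E) (x : Euc n) : ℝ≥0∞ :=
  essSup (fun y => (‖u y‖₊ : ℝ≥0∞)) (volume.restrict (ntRegion Ω κ x ∩ S))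

/-- Nontangential maximal function `N_κ u`. -/
def ntMax {E : Type*} [NormedAddCommGroup E] (Ω : Set (Euc n)) (κ : ℝ)
    (u : Euc n → E) (x : Euc n) : ℝ≥0∞ :=
  essSup (fun y => (‖u y‖₊ : ℝ≥0∞)) (volume.restrict (ntRegion Ω κ x))

/-- `u` has κ-nontangential trace `v` at the boundary point `x`. -/
def HasNTTrace {E : Type*} [NormedAddCommGroup E] (Ω : Set (Euc n)) (κ : ℝ)
    (u : Euc n → E) (x : Euc n) (v : E) : Prop :=
  x ∈ closure (ntRegion Ω κ x) ∧
  ∃ N : Set (Euc n), N ⊆ ntRegion Ω κ x ∧ volume N = 0 ∧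
    Tendsto u (nhdsWithin x (ntRegion Ω κ x \ N)) (nhds v)

/-- `Sig` is an Ahlfors regular set (of dimension `n-1`) with constant `C`. -/
def AhlforsRegularWith (n : ℕ) (Sig : Set (Euc n)) (C : ℝ) : Prop :=
  1 < C ∧ IsClosed Sig ∧ ∀ x ∈ Sig, ∀ r : ℝ, 0 < r →
    ENNReal.ofReal r < 2 * EMetric.diam Sig →
    ENNReal.ofReal (C⁻¹ * r ^ (n - 1)) ≤ μH[(n : ℝ) - 1] (Sig ∩ ball x r) ∧
      μH[(n : ℝ) - 1] (Sig ∩ ball x r) ≤ ENNReal.ofReal (C * r ^ (n - 1))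

/-- The measure-theoretic (geometric measure theoretic) boundary `∂*Ω`. -/
def mtBoundary (n : ℕ) (Ω : Set (Euc n)) : Set (Euc n) :=
  {x | 0 < limsup (fun r : ℝ => volume (Ω ∩ ball x r) / ENNReal.ofReal (r ^ n)) (𝓝[>] 0) ∧
       0 < limsup (fun r : ℝ => volume (Ωᶜ ∩ ball x r) / ENNReal.ofReal (r ^ n)) (𝓝[>] 0)}

/-- The nontangentially accessible boundary `∂_nta Ω`. -/
def ntaBoundary (n : ℕ) (Ω : Set (Euc n)) : Set (Euc n) :=
  {x | x ∈ frontier Ω ∧ ∀ κ : ℝ, 0 < κ → x ∈ closure (ntRegion Ω κ x)}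

/-- The Laplacian `Δu = ∑ ∂²u/∂x_j²`, via iterated Fréchet derivatives. -/
def laplacian (u : Euc n → ℝ) (x : Euc n) : ℝ :=
  ∑ i : Fin n, fderiv ℝ (fun z => fderiv ℝ u z (EuclideanSpace.single i 1)) x
    (EuclideanSpace.single i 1)

/-- `u` is harmonic on the open set `Ω`. -/
def HarmonicOn' (u : Euc n → ℝ) (Ω : Set (Euc n)) : Prop :=
  ContDiffOn ℝ 2 u Ω ∧ ∀ x ∈ Ω, laplacian u x = 0

/-- `w` is (continuous and) subharmonic on the open set `Ω`, via the sub-mean value property. -/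
def SubharmonicOn (w : Euc n → ℝ) (Ω : Set (Euc n)) : Prop :=
  ContinuousOn w Ω ∧ ∀ x ∈ Ω, ∀ r : ℝ, 0 < r → closedBall x r ⊆ Ω →
    w x ≤ ⨍ y in ball x r, w y

/-- `Sig` is a uniformly rectifiable (UR) set: closed, Ahlfors regular, with
Big Pieces of Lipschitz Images. -/
def IsURSet (n : ℕ) (Sig : Set (Euc n)) : Prop :=
  IsClosed Sig ∧ (∃ C : ℝ, AhlforsRegularWith n Sig C) ∧
  ∃ ε : ℝ, 0 < ε ∧ ∃ M₀ : ℝ≥0, ∀ x ∈ Sig, ∀ r : ℝ, 0 < r →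
    ENNReal.ofReal r < EMetric.diam Sig →
    ∃ Φ : EuclideanSpace ℝ (Fin (n - 1)) → Euc n, LipschitzWith M₀ Φ ∧
      ENNReal.ofReal (ε * r ^ (n - 1)) ≤
        μH[(n : ℝ) - 1] (Sig ∩ ball x r ∩ Φ '' ball (0 : EuclideanSpace ℝ (Fin (n - 1))) r)

end



/-- Convolution against a kernel. -/
noncomputable def cv {n : ℕ} (h ρ : Euc n → ℝ) : Euc n → ℝ := fun x => ∫ t, h t * ρ (x - t)

theorem cv_eq_conv {n : ℕ} (h ρ : Euc n → ℝ) :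
    cv h ρ = convolution h ρ (ContinuousLinearMap.mul ℝ ℝ) volume := by
  ext x; simp [cv, convolution]

theorem cv_contDiff {n : ℕ} {h ρ : Euc n → ℝ} (hh : LocallyIntegrable h volume)
    (hρ : ContDiff ℝ (⊤ : ℕ∞) ρ) (hc : HasCompactSupport ρ) :
    ContDiff ℝ (⊤ : ℕ∞) (cv h ρ) := by
  rw [cv_eq_conv]
  exact hc.contDiff_convolution_right _ hh hρ

theorem contDiff_dir {n : ℕ} {ρ : Euc n → ℝ} (hρ : ContDiff ℝ (⊤ : ℕ∞) ρ) (e : Euc n) :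
    ContDiff ℝ (⊤ : ℕ∞) (fun z => fderiv ℝ ρ z e) := by
  have := (hρ.fderiv_right (m := (⊤ : ℕ∞)) (by simp))
  exact this.clm_apply contDiff_const

theorem compactSupport_dir {n : ℕ} {ρ : Euc n → ℝ} (hc : HasCompactSupport ρ) (e : Euc n) :
    HasCompactSupport (fun z => fderiv ℝ ρ z e) := hc.fderiv_apply ℝ e

theorem fderiv_cv {n : ℕ} {h ρ : Euc n → ℝ} (hh : LocallyIntegrable h volume)
    (hρ : ContDiff ℝ (⊤ : ℕ∞) ρ) (hc : HasCompactSupport ρ) (x e : Euc n) :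
    fderiv ℝ (cv h ρ) x e = cv h (fun z => fderiv ℝ ρ z e) x := by
  have h1 : ContDiff ℝ 1 ρ := hρ.of_le (by simp)
  rw [cv_eq_conv, (hc.hasFDerivAt_convolution_right (ContinuousLinearMap.mul ℝ ℝ) hh h1 x).fderiv,
    convolution_precompR_apply _ hh (hc.fderiv ℝ) (h1.continuous_fderiv one_ne_zero), cv_eq_conv]

theorem laplacian_cv {n : ℕ} {h ρ : Euc n → ℝ} (hh : LocallyIntegrable h volume)
    (hρ : ContDiff ℝ (⊤ : ℕ∞) ρ) (hc : HasCompactSupport ρ) (x : Euc n) :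
    laplacian (cv h ρ) x = ∫ t, h t * laplacian ρ (x - t) := by
  unfold laplacian
  simp only [Finset.mul_sum]
  rw [integral_finsetSum]
  · refine Finset.sum_congr rfl fun i _ => ?_
    have : (fun z => fderiv ℝ (cv h ρ) z (EuclideanSpace.single i 1)) =
        cv h (fun z => fderiv ℝ ρ z (EuclideanSpace.single i 1)) := by
      ext z; exact fderiv_cv hh hρ hc z _
    rw [this, fderiv_cv hh (contDiff_dir hρ _) (compactSupport_dir hc _)]
    rfl
  · intro i _
    have hk := compactSupport_dir (compactSupport_dir hc (EuclideanSpace.single i (1:ℝ))) (EuclideanSpace.single i (1:ℝ))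
    have hd := contDiff_dir (contDiff_dir hρ (EuclideanSpace.single i (1:ℝ))) (EuclideanSpace.single i (1:ℝ))
    have := hk.convolutionExists_right (ContinuousLinearMap.mul ℝ ℝ) hh hd.continuous x
    exact this

theorem cv_normed_eq {n : ℕ} (φ : ContDiffBump (0 : Euc n)) (g : Euc n → ℝ) :
    cv g (φ.normed volume) = convolution (φ.normed volume) g (ContinuousLinearMap.lsmul ℝ ℝ) volume := by
  ext x
  rw [convolution_lsmul_swap]
  simp [cv, mul_comm]

theorem dist_cv_le {n : ℕ} (φ : ContDiffBump (0 : Euc n)) {g : Euc n → ℝ} {x : Euc n} {ε : ℝ}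
    (hmg : AEStronglyMeasurable g volume) (hg : ∀ y ∈ ball x φ.rOut, dist (g y) (g x) ≤ ε) :
    dist (cv g (φ.normed volume) x) (g x) ≤ ε := by
  rw [cv_normed_eq]
  exact φ.dist_normed_convolution_le hmg hg

theorem cv_eq_const {n : ℕ} (φ : ContDiffBump (0 : Euc n)) {g : Euc n → ℝ} {x : Euc n}
    (hg : ∀ y ∈ ball x φ.rOut, g y = g x) :
    cv g (φ.normed volume) x = g x := by
  rw [cv_normed_eq]
  exact φ.normed_convolution_eq_right hg

theorem integral_fderiv_zero {n : ℕ} {F : Euc n → ℝ} (hF : ContDiff ℝ 1 F)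
    (hc : HasCompactSupport F) (e : Euc n) : ∫ x, fderiv ℝ F x e = 0 := by
  have h1 : Continuous (fun x => fderiv ℝ F x e) :=
    (hF.continuous_fderiv one_ne_zero).clm_apply continuous_const
  have := integral_mul_fderiv_eq_neg_fderiv_mul_of_integrable (μ := (volume : Measure (Euc n)))
    (f := fun _ => (1:ℝ)) (g := F) (v := e) (by simp)
    (by simpa using h1.integrable_of_hasCompactSupport (hc.fderiv_apply ℝ e))
    (by simpa using hF.continuous.integrable_of_hasCompactSupport hc)
    (by intro x _; fun_prop) (by intro x _; exact hF.differentiable one_ne_zero x)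
  simpa using this

theorem contDiff_of_zero_off {n : ℕ} {m : WithTop ℕ∞} {F : Euc n → ℝ} {U K : Set (Euc n)}
    (hU : IsOpen U) (hK : IsClosed K) (hKU : K ⊆ U) (hF : ContDiffOn ℝ m F U)
    (h0 : ∀ x ∉ K, F x = 0) : ContDiff ℝ m F := by
  rw [contDiff_iff_contDiffAt]
  intro x
  by_cases hx : x ∈ K
  · exact hF.contDiffAt (hU.mem_nhds (hKU hx))
  · have : F =ᶠ[𝓝 x] fun _ => 0 := by
      filter_upwards [hK.isOpen_compl.mem_nhds hx] with y hy using h0 y hy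
    exact contDiffAt_const.congr_of_eventuallyEq this

theorem fderiv_zero_off {n : ℕ} {F : Euc n → ℝ} {K : Set (Euc n)}
    (hK : IsClosed K) {c : ℝ} (h0 : ∀ x ∉ K, F x = c) : ∀ x ∉ K, fderiv ℝ F x = 0 := by
  intro x hx
  have : F =ᶠ[𝓝 x] fun _ => c := by
    filter_upwards [hK.isOpen_compl.mem_nhds hx] with y hy using h0 y hy
  rw [this.fderiv_eq]; simp

theorem laplacian_zero_off {n : ℕ} {F : Euc n → ℝ} {K : Set (Euc n)}
    (hK : IsClosed K) {c : ℝ} (h0 : ∀ x ∉ K, F x = c) : ∀ x ∉ K, laplacian F x = 0 := by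
  intro x hx
  unfold laplacian
  refine Finset.sum_eq_zero fun i _ => ?_
  rw [fderiv_zero_off hK (c := 0) (F := fun z => fderiv ℝ F z (EuclideanSpace.single i 1)) ?_ x hx]
  · rfl
  · intro y hy; rw [fderiv_zero_off hK h0 y hy]; rfl

theorem compactSupport_of_zero_off {n : ℕ} {F : Euc n → ℝ} {K : Set (Euc n)}
    (hK : IsCompact K) (h0 : ∀ x ∉ K, F x = 0) : HasCompactSupport F :=
  HasCompactSupport.intro hK h0


theorem contDiffOn_dir {n : ℕ} {u : Euc n → ℝ} {U : Set (Euc n)} {m k : WithTop ℕ∞} (hU : IsOpen U)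
    (hu : ContDiffOn ℝ k u U) (hmk : m + 1 ≤ k) (e : Euc n) :
    ContDiffOn ℝ m (fun z => fderiv ℝ u z e) U :=
  (hu.fderiv_of_isOpen hU hmk).clm_apply contDiffOn_const

theorem integral_mul_laplacian_zero {n : ℕ} {Ω K : Set (Euc n)} (hΩ : IsOpen Ω) (hK : IsCompact K)
    (hKΩ : K ⊆ Ω) {u θ : Euc n → ℝ} (hu : HarmonicOn' u Ω) (hθ : ContDiff ℝ (⊤ : ℕ∞) θ)
    (hθ0 : ∀ x ∉ K, θ x = 0) : ∫ x, u x * laplacian θ x = 0 := by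
  let e : Fin n → Euc n := fun i => EuclideanSpace.single i 1
  let F : Fin n → Euc n → ℝ := fun i x => u x * fderiv ℝ θ x (e i) - θ x * fderiv ℝ u x (e i)
  have hθ0' := fderiv_zero_off hK.isClosed hθ0
  have hF0 : ∀ i, ∀ x ∉ K, F i x = 0 := by
    intro i x hx; simp [F, hθ0 x hx, hθ0' x hx]
  have hFon : ∀ i, ContDiffOn ℝ 1 (F i) Ω := by
    intro i
    have a1 : ContDiffOn ℝ 1 u Ω := hu.1.of_le (by norm_num)
    have a2 : ContDiffOn ℝ 1 (fun z => fderiv ℝ u z (e i)) Ω := contDiffOn_dir hΩ hu.1 (by norm_num) _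
    have a3 : ContDiff ℝ 1 θ := hθ.of_le (by simp)
    have a4 : ContDiff ℝ 1 (fun z => fderiv ℝ θ z (e i)) := (contDiff_dir hθ _).of_le (by simp)
    exact (a1.mul a4.contDiffOn).sub (a3.contDiffOn.mul a2)
  have hF : ∀ i, ContDiff ℝ 1 (F i) := fun i =>
    contDiff_of_zero_off hΩ hK.isClosed hKΩ (hFon i) (hF0 i)
  have hFc : ∀ i, HasCompactSupport (F i) := fun i => compactSupport_of_zero_off hK (hF0 i)
  have key : ∀ x, u x * laplacian θ x = ∑ i, fderiv ℝ (F i) x (e i) := by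
    intro x
    by_cases hx : x ∈ Ω
    · have a1 : DifferentiableAt ℝ u x := (hu.1.contDiffAt (hΩ.mem_nhds hx)).differentiableAt (by norm_num)
      have a2 : ∀ i, DifferentiableAt ℝ (fun z => fderiv ℝ u z (e i)) x := fun i =>
        ((contDiffOn_dir (m := 1) hΩ hu.1 (by norm_num) (e i)).contDiffAt (hΩ.mem_nhds hx)).differentiableAt
          (by norm_num)
      have a3 : DifferentiableAt ℝ θ x := hθ.differentiable (by simp) x
      have a4 : ∀ i, DifferentiableAt ℝ (fun z => fderiv ℝ θ z (e i)) x := fun i =>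
        (contDiff_dir hθ (e i)).differentiable (by simp) x
      have h2 := hu.2 x hx
      have : ∀ i, fderiv ℝ (F i) x (e i) =
          u x * fderiv ℝ (fun z => fderiv ℝ θ z (e i)) x (e i)
          - θ x * fderiv ℝ (fun z => fderiv ℝ u z (e i)) x (e i) := by
        intro i
        have := ((a1.hasFDerivAt.mul (a4 i).hasFDerivAt).sub
          (a3.hasFDerivAt.mul (a2 i).hasFDerivAt)).fderiv
        have h3 : fderiv ℝ (F i) x = _ := this
        rw [h3]
        simp
        ring
      simp only [this, Finset.sum_sub_distrib, ← Finset.mul_sum]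
      have h2' : ∑ i, fderiv ℝ (fun z => fderiv ℝ u z (e i)) x (e i) = 0 := h2
      rw [h2']
      simp [laplacian, e]
    · have hx' : x ∉ K := fun h => hx (hKΩ h)
      rw [laplacian_zero_off hK.isClosed hθ0 x hx']
      simp only [mul_zero]
      symm
      refine Finset.sum_eq_zero fun i _ => ?_
      rw [fderiv_zero_off hK.isClosed (hF0 i) x hx']; rfl
  simp only [key]
  rw [integral_finsetSum]
  · exact Finset.sum_eq_zero fun i _ => integral_fderiv_zero (hF i) (hFc i) _
  · intro i _
    exact (((hF i).continuous_fderiv one_ne_zero).clm_apply continuous_const).integrable_of_hasCompactSupport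
      ((hFc i).fderiv_apply ℝ _)

theorem laplacian_mul {n : ℕ} {ψ f : Euc n → ℝ} (hψ : ContDiff ℝ (⊤ : ℕ∞) ψ)
    (hf : ContDiff ℝ (⊤ : ℕ∞) f) (x : Euc n) :
    laplacian (fun z => ψ z * f z) x = ψ x * laplacian f x
      + 2 * ∑ i : Fin n, fderiv ℝ ψ x (EuclideanSpace.single i 1) * fderiv ℝ f x (EuclideanSpace.single i 1)
      + f x * laplacian ψ x := by
  unfold laplacian
  simp only [Finset.mul_sum, ← Finset.sum_add_distrib]
  refine Finset.sum_congr rfl fun i _ => ?_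
  set e : Euc n := EuclideanSpace.single i 1
  have a1 : ∀ x, DifferentiableAt ℝ ψ x := fun x => hψ.differentiable (by simp) x
  have a2 : ∀ x, DifferentiableAt ℝ f x := fun x => hf.differentiable (by simp) x
  have a3 : DifferentiableAt ℝ (fun z => fderiv ℝ ψ z e) x := (contDiff_dir hψ e).differentiable (by simp) x
  have a4 : DifferentiableAt ℝ (fun z => fderiv ℝ f z e) x := (contDiff_dir hf e).differentiable (by simp) x
  have h1 : (fun z => fderiv ℝ (fun z => ψ z * f z) z e) =
      fun z => ψ z * fderiv ℝ f z e + f z * fderiv ℝ ψ z e := by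
    ext z
    have h3 : fderiv ℝ (fun z => ψ z * f z) z = _ := ((a1 z).hasFDerivAt.mul (a2 z).hasFDerivAt).fderiv
    rw [h3]; simp
  have h3 : fderiv ℝ (fun z => ψ z * fderiv ℝ f z e + f z * fderiv ℝ ψ z e) x = _ :=
    (((a1 x).hasFDerivAt.mul a4.hasFDerivAt).add ((a2 x).hasFDerivAt.mul a3.hasFDerivAt)).fderiv
  rw [h1, h3]
  simp
  ring

theorem continuous_laplacian {n : ℕ} {f : Euc n → ℝ} (hf : ContDiff ℝ (⊤ : ℕ∞) f) :
    Continuous (laplacian f) := by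
  unfold laplacian
  exact continuous_finsetSum _ fun i _ => (contDiff_dir (contDiff_dir hf _) _).continuous

/-- The error density. -/
noncomputable def errD {n : ℕ} (G ψ : Euc n → ℝ) (x : Euc n) : ℝ :=
  2 * ∑ i : Fin n, fderiv ℝ G x (EuclideanSpace.single i 1) * fderiv ℝ ψ x (EuclideanSpace.single i 1)
    + G x * laplacian ψ x

theorem errD_zero_off {n : ℕ} {G ψ : Euc n → ℝ} {M : Set (Euc n)} (hM : IsClosed M)
    (h : ∀ x ∉ M, fderiv ℝ ψ x = 0) : ∀ x ∉ M, errD G ψ x = 0 := by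
  intro x hx
  have : laplacian ψ x = 0 := by
    unfold laplacian
    refine Finset.sum_eq_zero fun i _ => ?_
    rw [fderiv_zero_off hM (c := 0) (F := fun z => fderiv ℝ ψ z (EuclideanSpace.single i 1)) ?_ x hx]
    · rfl
    · intro y hy; rw [h y hy]; rfl
  simp [errD, this, h x hx]

theorem errD_continuous {n : ℕ} {G ψ : Euc n → ℝ} {M U : Set (Euc n)} (hU : IsOpen U)
    (hM : IsClosed M) (hMU : M ⊆ U) (hG : ContDiffOn ℝ (⊤ : ℕ∞) G U)
    (hψ : ContDiff ℝ (⊤ : ℕ∞) ψ)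
    (h : ∀ x ∉ M, fderiv ℝ ψ x = 0) : Continuous (errD G ψ) := by
  rw [← contDiff_zero (𝕜 := ℝ)]
  refine contDiff_of_zero_off hU hM hMU ?_ (errD_zero_off hM h)
  rw [contDiffOn_zero]
  unfold errD
  refine ContinuousOn.add (continuousOn_const.mul (continuousOn_finsetSum _ fun i _ => ?_)) ?_
  · exact (contDiffOn_dir (m := (⊤ : ℕ∞)) hU hG (by simp) _).continuousOn.mul
      (contDiff_dir hψ _).continuous.continuousOn
  · exact hG.continuousOn.mul (continuous_laplacian hψ).continuousOn

theorem green_key {n : ℕ} {Ω K M : Set (Euc n)} (hΩ : IsOpen Ω) (hK : IsCompact K) (hKΩ : K ⊆ Ω)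
    {x₀ : Euc n} (hM : IsCompact M) (hMΩ : M ⊆ Ω \ {x₀}) {G : Euc n → ℝ}
    (hG1 : ContDiffOn ℝ (⊤ : ℕ∞) G (Ω \ {x₀}))
    (hG2 : ∀ x ∈ Ω \ {x₀}, 0 < G x)
    (hG3 : LocallyIntegrableOn G Ω volume)
    (hG4 : ∀ φ : Euc n → ℝ, ContDiff ℝ (⊤ : ℕ∞) φ → HasCompactSupport φ → tsupport φ ⊆ Ω →
      ∫ x in Ω, G x * laplacian φ x = -(φ x₀))
    {ψ f : Euc n → ℝ} (hψ : ContDiff ℝ (⊤ : ℕ∞) ψ) (hψ0 : ∀ x, 0 ≤ ψ x)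
    (hψK : ∀ x ∉ K, ψ x = 0) (hψ1 : ψ x₀ = 1) (hψM : ∀ x ∉ M, fderiv ℝ ψ x = 0)
    (hf : ContDiff ℝ (⊤ : ℕ∞) f) (hfK : ∀ x ∈ K, 0 ≤ laplacian f x)
    (hnull : volume ({x₀} : Set (Euc n)) = 0) :
    f x₀ ≤ ∫ x, f x * errD G ψ x := by
  let e : Fin n → Euc n := fun i => EuclideanSpace.single i 1
  have hU : IsOpen (Ω \ {x₀}) := hΩ.sdiff isClosed_singleton
  let F : Fin n → Euc n → ℝ := fun i x => G x * (f x * fderiv ℝ ψ x (e i))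
  have hF0 : ∀ i, ∀ x ∉ M, F i x = 0 := by
    intro i x hx; simp [F, hψM x hx]
  have hF : ∀ i, ContDiff ℝ 1 (F i) := by
    intro i
    refine contDiff_of_zero_off hU hM.isClosed hMΩ ?_ (hF0 i)
    have : ContDiffOn ℝ (⊤ : ℕ∞) (F i) (Ω \ {x₀}) :=
      hG1.mul (hf.mul (contDiff_dir hψ _)).contDiffOn
    exact this.of_le (by simp)
  have hFc : ∀ i, HasCompactSupport (F i) := fun i => compactSupport_of_zero_off hM (hF0 i)
  have hFint : ∀ i, Integrable (fun x => fderiv ℝ (F i) x (e i)) := fun i =>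
    (((hF i).continuous_fderiv one_ne_zero).clm_apply continuous_const).integrable_of_hasCompactSupport
      ((hFc i).fderiv_apply ℝ _)
  have hψf : ContDiff ℝ (⊤ : ℕ∞) (fun z => ψ z * f z) := hψ.mul hf
  have hψfK : ∀ x ∉ K, ψ x * f x = 0 := fun x hx => by simp [hψK x hx]
  have hlapK := laplacian_zero_off hK.isClosed hψfK
  have hGK : ∀ g : Euc n → ℝ, Continuous g → (∀ x ∉ K, g x = 0) → Integrable (fun x => G x * g x) := by
    intro g hg hg0
    have h1 : IntegrableOn G K volume := hG3.integrableOn_compact_subset hKΩ hK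
    have h2 : IntegrableOn (fun x => G x * g x) K volume := h1.mul_continuousOn hg.continuousOn hK
    rw [integrableOn_iff_integrable_of_support_subset] at h2
    · exact h2
    · intro x hx
      by_contra h
      exact hx (by simp [hg0 x h])
  have hpt : ∀ x, x ≠ x₀ → G x * laplacian (fun z => ψ z * f z) x + f x * errD G ψ x
      = G x * (ψ x * laplacian f x) + 2 * ∑ i, fderiv ℝ (F i) x (e i) := by
    intro x hx
    by_cases hxM : x ∈ M
    · have hxU := hU.mem_nhds (hMΩ hxM)
      have a0 : DifferentiableAt ℝ G x := (hG1.contDiffAt hxU).differentiableAt (by simp)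
      have a2 : DifferentiableAt ℝ f x := hf.differentiable (by simp) x
      have a3 : ∀ i, DifferentiableAt ℝ (fun z => fderiv ℝ ψ z (e i)) x := fun i =>
        (contDiff_dir hψ (e i)).differentiable (by simp) x
      have hd : ∀ i, fderiv ℝ (F i) x (e i) = f x * (fderiv ℝ G x (e i) * fderiv ℝ ψ x (e i))
          + G x * (fderiv ℝ ψ x (e i) * fderiv ℝ f x (e i))
          + G x * f x * fderiv ℝ (fun z => fderiv ℝ ψ z (e i)) x (e i) := by
        intro i
        have h3 : fderiv ℝ (F i) x = _ :=
          (a0.hasFDerivAt.mul (a2.hasFDerivAt.mul (a3 i).hasFDerivAt)).fderiv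
        rw [h3]; simp; ring
      simp only [hd, Finset.sum_add_distrib, ← Finset.mul_sum]
      rw [laplacian_mul hψ hf]
      simp only [errD]
      have : ∑ i, fderiv ℝ (fun z => fderiv ℝ ψ z (e i)) x (e i) = laplacian ψ x := rfl
      rw [this]
      simp only [e]
      ring
    · have h1 := errD_zero_off (G := G) hM.isClosed hψM x hxM
      have h2 : ∀ i, fderiv ℝ (F i) x (e i) = 0 := by
        intro i; rw [fderiv_zero_off hM.isClosed (hF0 i) x hxM]; rfl
      have h4 : laplacian ψ x = 0 := by
        have := errD_zero_off (G := fun _ => 1) hM.isClosed hψM x hxM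
        simpa [errD, hψM x hxM] using this
      simp only [h1, h2, laplacian_mul hψ hf, hψM x hxM, h4]
      simp
  have hDc : Continuous (fun x => f x * errD G ψ x) :=
    hf.continuous.mul (errD_continuous hU hM.isClosed hMΩ hG1 hψ hψM)
  have hDi : Integrable (fun x => f x * errD G ψ x) :=
    hDc.integrable_of_hasCompactSupport (compactSupport_of_zero_off hM fun x hx => by
      simp [errD_zero_off (G := G) hM.isClosed hψM x hx])
  have i1 : Integrable (fun x => G x * laplacian (fun z => ψ z * f z) x) :=
    hGK _ (continuous_laplacian hψf) hlapK
  have i2 : Integrable (fun x => G x * (ψ x * laplacian f x)) :=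
    hGK _ (hψ.continuous.mul (continuous_laplacian hf)) (fun x hx => by simp [hψK x hx])
  have hne : ∀ᵐ x ∂(volume : Measure (Euc n)), x ≠ x₀ := by
    rw [ae_iff]; simpa using hnull
  have hint : (∫ x, G x * laplacian (fun z => ψ z * f z) x) + ∫ x, f x * errD G ψ x
      = (∫ x, G x * (ψ x * laplacian f x)) := by
    rw [← integral_add i1 hDi]
    have : ∫ x, (G x * laplacian (fun z => ψ z * f z) x + f x * errD G ψ x)
        = ∫ x, (G x * (ψ x * laplacian f x) + 2 * ∑ i, fderiv ℝ (F i) x (e i)) := by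
      refine integral_congr_ae ?_
      filter_upwards [hne] with x hx using hpt x hx
    rw [this, integral_add i2 ((integrable_finsetSum _ fun i _ => hFint i).const_mul 2),
      integral_const_mul, integral_finsetSum _ fun i _ => hFint i]
    rw [Finset.sum_eq_zero fun i _ => integral_fderiv_zero (hF i) (hFc i) _]
    simp
  have hnn : 0 ≤ ∫ x, G x * (ψ x * laplacian f x) := by
    refine integral_nonneg_of_ae ?_
    filter_upwards [hne] with x hx
    by_cases hxK : x ∈ K
    · exact mul_nonneg (hG2 x ⟨hKΩ hxK, hx⟩).le (mul_nonneg (hψ0 x) (hfK x hxK))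
    · simp [hψK x hxK]
  have hts : tsupport (fun z => ψ z * f z) ⊆ K := by
    refine closure_minimal ?_ hK.isClosed
    intro x hx
    by_contra h
    exact hx (hψfK x h)
  have h4 := hG4 _ hψf (compactSupport_of_zero_off hK hψfK) (hts.trans hKΩ)
  rw [setIntegral_eq_integral_of_forall_compl_eq_zero] at h4
  · rw [h4] at hint
    simp only [hψ1, one_mul] at hint
    linarith
  · intro x hx
    rw [hlapK x fun h => hx (hKΩ h)]; simp


theorem ball_integral_isom {n : ℕ} (T : Euc n ≃ₗᵢ[ℝ] Euc n) (g : Euc n → ℝ) (r : ℝ) :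
    ∫ y in ball (0 : Euc n) r, g (T y) = ∫ y in ball (0 : Euc n) r, g y := by
  have h := T.measurePreserving.setIntegral_preimage_emb T.toHomeomorph.measurableEmbedding g (ball 0 r)
  rw [T.preimage_ball] at h
  simpa using h

theorem ball_integral_odd {n : ℕ} (ℓ : Euc n →L[ℝ] ℝ) (r : ℝ) :
    ∫ y in ball (0 : Euc n) r, ℓ y = 0 := by
  have h := ball_integral_isom (LinearIsometryEquiv.neg ℝ) (fun y => ℓ y) r
  simp only [LinearIsometryEquiv.coe_neg, map_neg, integral_neg] at h
  linarith

theorem ball_integral_cross {n : ℕ} {i j : Fin n} (hij : i ≠ j) (r : ℝ) :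
    ∫ y in ball (0 : Euc n) r, y i * y j = 0 := by
  let T : Euc n ≃ₗᵢ[ℝ] Euc n := LinearIsometryEquiv.piLpCongrRight 2
    (fun k => if k = i then LinearIsometryEquiv.neg ℝ else LinearIsometryEquiv.refl ℝ ℝ)
  have h := ball_integral_isom T (fun y => y i * y j) r
  have h1 : ∀ y, (T y) i * (T y) j = -(y i * y j) := by
    intro y
    simp [T, LinearIsometryEquiv.piLpCongrRight_apply, hij.symm]
  simp only [h1, integral_neg] at h
  linarith

theorem ball_integral_sq {n : ℕ} (i j : Fin n) (r : ℝ) :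
    ∫ y in ball (0 : Euc n) r, y i * y i = ∫ y in ball (0 : Euc n) r, y j * y j := by
  let T : Euc n ≃ₗᵢ[ℝ] Euc n := LinearIsometryEquiv.piLpCongrLeft 2 ℝ ℝ (Equiv.swap i j)
  have h := ball_integral_isom T (fun y => y j * y j) r
  have h1 : ∀ y, (T y) j = y i := by
    intro y
    simp [T, LinearIsometryEquiv.piLpCongrLeft_apply, Equiv.piCongrLeft']
  simp only [h1] at h
  exact h

theorem ball_integrable {n : ℕ} {g : Euc n → ℝ} (hg : Continuous g) (r : ℝ) :
    IntegrableOn g (ball (0 : Euc n) r) volume :=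
  (hg.continuousOn.integrableOn_compact (isCompact_closedBall 0 r)).mono_set ball_subset_closedBall

theorem taylor_two {n : ℕ} {f : Euc n → ℝ} (hf : ContDiff ℝ (⊤ : ℕ∞) f) (x : Euc n) {η : ℝ} (hη : 0 < η) :
    ∃ δ > 0, ∀ y, ‖y‖ < δ →
      f (x + y) - f x ≤ fderiv ℝ f x y + (1/2) * fderiv ℝ (fderiv ℝ f) x y y + η * ‖y‖^2 := by
  set Q := fderiv ℝ (fderiv ℝ f) x with hQ
  have hsymm : ∀ v w, Q v w = Q w v := fun v w =>
    ((contDiff_infty.1 hf 2).contDiffAt.isSymmSndFDerivAt (by simp)) v w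
  have hd : DifferentiableAt ℝ (fderiv ℝ f) x :=
    (hf.fderiv_right (m := 1) (by norm_cast)).differentiable one_ne_zero x
  have hlo := (hasFDerivAt_iff_isLittleO_nhds_zero.1 hd.hasFDerivAt).def hη
  obtain ⟨δ, hδ, hball⟩ := Metric.eventually_nhds_iff.1 hlo
  refine ⟨δ, hδ, fun y hy => ?_⟩
  let Ψ : Euc n → ℝ := fun y => f (x + y) - f x - fderiv ℝ f x y - (1/2) * Q y y
  have hΨ : ∀ z, HasFDerivAt Ψ (fderiv ℝ f (x + z) - fderiv ℝ f x - Q z) z := by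
    intro z
    have h1 : HasFDerivAt (fun z => f (x + z)) (fderiv ℝ f (x + z)) z := by
      have := (hf.differentiable (by simp) (x + z)).hasFDerivAt
      exact (hasFDerivAt_comp_add_left x).2 this
    have h2 : HasFDerivAt (fun z => Q z z) ((Q z).comp (ContinuousLinearMap.id ℝ _) + Q.flip z) z := by
      exact Q.hasFDerivAt.clm_apply (hasFDerivAt_id z)
    have h3 := ((h1.sub_const (f x)).sub (fderiv ℝ f x).hasFDerivAt).sub (h2.const_mul (1/2))
    refine h3.congr_fderiv ?_
    ext v
    simp [hsymm v z]
    ring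
  have hb : ∀ z ∈ closedBall (0 : Euc n) ‖y‖, ‖fderiv ℝ f (x + z) - fderiv ℝ f x - Q z‖ ≤ η * ‖y‖ := by
    intro z hz
    have hz' : ‖z‖ ≤ ‖y‖ := by simpa using hz
    refine (hball (y := z) (by simpa using hz'.trans_lt hy)).trans ?_
    gcongr
  have := (convex_closedBall (0 : Euc n) ‖y‖).norm_image_sub_le_of_norm_hasFDerivWithin_le
    (fun z _ => (hΨ z).hasFDerivWithinAt) hb (x := 0) (y := y) (by simp) (by simp)
  have h0 : Ψ 0 = 0 := by simp [Ψ]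
  rw [h0] at this
  have h5 := (le_abs_self _).trans this
  simp only [Ψ, sub_zero] at h5
  nlinarith [h5]

theorem laplacian_nonneg_of_submean {n : ℕ} {f : Euc n → ℝ} (hf : ContDiff ℝ (⊤ : ℕ∞) f) (x : Euc n)
    {r₀ : ℝ} (hr₀ : 0 < r₀) (h : ∀ r, 0 < r → r < r₀ → 0 ≤ ∫ y in ball (0 : Euc n) r, (f (x + y) - f x)) :
    0 ≤ laplacian f x := by
  rcases Nat.eq_zero_or_pos n with rfl | hn
  · simp [laplacian]
  let i₀ : Fin n := ⟨0, hn⟩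
  set Q := fderiv ℝ (fderiv ℝ f) x with hQ
  have hd : DifferentiableAt ℝ (fderiv ℝ f) x :=
    (hf.fderiv_right (m := 1) (by norm_cast)).differentiable one_ne_zero x
  have hlap : laplacian f x = ∑ i : Fin n, Q (EuclideanSpace.single i 1) (EuclideanSpace.single i 1) := by
    unfold laplacian
    refine Finset.sum_congr rfl fun i _ => ?_
    have : HasFDerivAt (fun z => fderiv ℝ f z (EuclideanSpace.single i (1:ℝ))) _ x :=
      hd.hasFDerivAt.clm_apply (hasFDerivAt_const _ x)
    rw [this.fderiv]
    simp [hQ]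
  have hQy : ∀ y : Euc n, Q y y = ∑ i : Fin n, ∑ j : Fin n, (y i * y j) *
      Q (EuclideanSpace.single i 1) (EuclideanSpace.single j 1) := by
    intro y
    have hy : y = ∑ i : Fin n, y i • (EuclideanSpace.single i (1:ℝ) : Euc n) := by
      simpa using ((EuclideanSpace.basisFun (Fin n) ℝ).sum_repr y).symm
    conv_lhs => rw [hy]
    simp only [map_sum, map_smul, sum_apply, smul_apply,
      smul_eq_mul, Finset.mul_sum]
    rw [Finset.sum_comm]
    refine Finset.sum_congr rfl fun i _ => Finset.sum_congr rfl fun j _ => by ring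
  by_contra hneg
  push Not at hneg
  set η : ℝ := - laplacian f x / (4 * n) with hηd
  have hn' : (0:ℝ) < n := by exact_mod_cast hn
  have hη : 0 < η := by apply div_pos <;> linarith
  obtain ⟨δ, hδ, ht⟩ := taylor_two hf x hη
  set r := min r₀ δ / 2 with hr
  have hr0 : 0 < r := by have := lt_min hr₀ hδ; linarith
  have hr1 : r < r₀ := by have := min_le_left r₀ δ; linarith
  have hr2 : r < δ := by have := min_le_right r₀ δ; linarith
  have hI := h r hr0 hr1
  set B := ball (0 : Euc n) r
  set c := ∫ y in B, y i₀ * y i₀ with hc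
  have hcont : ∀ i : Fin n, Continuous (fun y : Euc n => y i) := fun i => by fun_prop
  have hcpos : 0 < c := by
    rw [hc]
    refine (setIntegral_pos_iff_support_of_nonneg_ae ?_ ?_).2 ?_
    · exact Eventually.of_forall fun y => mul_self_nonneg _
    · exact ball_integrable ((hcont i₀).mul (hcont i₀)) r
    · refine IsOpen.measure_pos _ ?_ ?_
      · refine IsOpen.inter ?_ isOpen_ball
        exact ((hcont i₀).mul (hcont i₀)).isOpen_support
      · refine ⟨EuclideanSpace.single i₀ (r/2), ?_, ?_⟩
        · simp [hr0.ne']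
        · simp [B, abs_of_pos hr0, hr0]
  have hci : ∀ i : Fin n, ∫ y in B, y i * y i = c := fun i => ball_integral_sq i i₀ r
  have i1 : IntegrableOn (fun y => fderiv ℝ f x y) B volume := ball_integrable (by fun_prop) r
  have i2 : IntegrableOn (fun y => Q y y) B volume := ball_integrable (by fun_prop) r
  have i3 : IntegrableOn (fun y : Euc n => ‖y‖^2) B volume := ball_integrable (by fun_prop) r
  have hQint : ∫ y in B, Q y y = c * laplacian f x := by
    simp only [hQy]
    rw [integral_finsetSum]
    · rw [hlap, Finset.mul_sum]
      refine Finset.sum_congr rfl fun i _ => ?_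
      rw [integral_finsetSum]
      · simp only [integral_mul_const]
        rw [Finset.sum_eq_single i]
        · rw [hci]
        · intro j _ hj
          rw [ball_integral_cross hj.symm]; simp
        · simp
      · intro j _
        exact ball_integrable (((hcont i).mul (hcont j)).mul continuous_const) r
    · intro i _
      exact ball_integrable (continuous_finsetSum _ fun j _ => ((hcont i).mul (hcont j)).mul continuous_const) r
  have hnint : ∫ y in B, ‖y‖^2 = n * c := by
    have : ∀ y : Euc n, ‖y‖^2 = ∑ i, y i * y i := by
      intro y
      rw [EuclideanSpace.norm_sq_eq]
      refine Finset.sum_congr rfl fun i _ => by simp [sq]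
    simp only [this]
    rw [integral_finsetSum]
    · simp [hci]
    · intro i _
      exact ball_integrable ((hcont i).mul (hcont i)) r
  have hle : ∫ y in B, (f (x + y) - f x) ≤
      ∫ y in B, (fderiv ℝ f x y + (1/2) * Q y y + η * ‖y‖^2) := by
    refine setIntegral_mono_on ?_ ((i1.add (i2.const_mul _)).add (i3.const_mul _)) measurableSet_ball ?_
    · have := hf.continuous
      exact ball_integrable (by fun_prop) r
    · intro y hy
      exact ht y (lt_trans (by simpa [B] using hy) hr2)
  have i12 : IntegrableOn (fun y => fderiv ℝ f x y + (1/2) * Q y y) B volume := i1.add (i2.const_mul _)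
  rw [integral_add i12 (i3.const_mul _), integral_add i1 (i2.const_mul _),
    integral_const_mul, integral_const_mul, ball_integral_odd, hQint, hnint] at hle
  have h6 : η * (n * c) = - laplacian f x / 4 * c := by
    rw [hηd]; field_simp
  rw [h6] at hle
  nlinarith [mul_pos hcpos (neg_pos.2 hneg)]


theorem ind_measurable {n : ℕ} {g : Euc n → ℝ} {K : Set (Euc n)} (hK : IsCompact K)
    (hg : ContinuousOn g K) : Measurable (K.indicator g) := by
  classical
  rw [← Set.piecewise_eq_indicator]
  exact hg.measurable_piecewise continuousOn_const hK.measurableSet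

theorem ind_bound {n : ℕ} {g : Euc n → ℝ} {K : Set (Euc n)} (hK : IsCompact K)
    (hg : ContinuousOn g K) : ∃ C, 0 ≤ C ∧ ∀ x, ‖K.indicator g x‖ ≤ C := by
  obtain ⟨C, hC⟩ := hK.exists_bound_of_continuousOn hg
  refine ⟨max C 0, le_max_right _ _, fun x => ?_⟩
  by_cases hx : x ∈ K
  · simpa [hx] using Or.inl (hC x hx)
  · simp [hx]

theorem ind_integrable {n : ℕ} {g : Euc n → ℝ} {K : Set (Euc n)} (hK : IsCompact K)
    (hg : ContinuousOn g K) : Integrable (K.indicator g) :=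
  (hg.integrableOn_compact hK).integrable_indicator hK.measurableSet

theorem cv_swap {n : ℕ} (h ρ : Euc n → ℝ) (x : Euc n) : cv h ρ x = ∫ s, h (x - s) * ρ s := by
  have := integral_sub_left_eq_self (fun t => h t * ρ (x - t)) (volume : Measure (Euc n)) x
  simp only [sub_sub_cancel] at this
  rw [this]; rfl

theorem ball_translate {n : ℕ} (w : Euc n → ℝ) (z : Euc n) (r : ℝ) :
    ∫ y in ball z r, w y = ∫ y in ball (0 : Euc n) r, w (z + y) := by
  have h := (measurePreserving_add_left (volume : Measure (Euc n)) z).setIntegral_preimage_emb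
    (measurableEmbedding_addLeft z) w (ball z r)
  rw [← h]
  congr 2
  ext y; simp

theorem submean_cv {n : ℕ} {Ω K : Set (Euc n)} (hK : IsCompact K) (hKΩ : K ⊆ Ω) {w : Euc n → ℝ}
    (hw : SubharmonicOn w Ω) (φ : ContDiffBump (0 : Euc n)) {x : Euc n} {r : ℝ} (hr : 0 < r)
    (hx : closedBall x (φ.rOut + r) ⊆ K) :
    0 ≤ ∫ y in ball (0 : Euc n) r,
      (cv (K.indicator w) (φ.normed volume) (x + y) - cv (K.indicator w) (φ.normed volume) x) := by
  have hwK : ContinuousOn w K := hw.1.mono hKΩ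
  set h := K.indicator w with hh
  obtain ⟨C, hC0, hC⟩ := ind_bound hK hwK
  have hm : Measurable h := ind_measurable hK hwK
  set ρ := φ.normed (volume : Measure (Euc n)) with hρ
  have hρi : Integrable ρ := φ.integrable_normed
  have hint1 : ∀ z, Integrable (fun s => h (z - s) * ρ s) := by
    intro z
    refine hρi.bdd_mul (c := C) ?_ ?_
    · exact (hm.comp (measurable_const.sub measurable_id)).aestronglyMeasurable
    · exact Eventually.of_forall fun s => hC _
  set B := ball (0 : Euc n) r
  have e1 : ∀ y, cv h ρ (x + y) - cv h ρ x = ∫ s, (h (x + y - s) - h (x - s)) * ρ s := by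
    intro y
    rw [cv_swap, cv_swap, ← integral_sub (hint1 _) (hint1 _)]
    simp only [sub_mul]
  simp only [e1]
  haveI : IsFiniteMeasure ((volume : Measure (Euc n)).restrict B) := ⟨by
    simp [B, measure_ball_lt_top]⟩
  have hF : Integrable (fun q : Euc n × Euc n => (h (x + q.1 - q.2) - h (x - q.2)) * ρ q.2)
      (((volume : Measure (Euc n)).restrict B).prod volume) := by
    have hi : Integrable (fun q : Euc n × Euc n => ρ q.2)
        (((volume : Measure (Euc n)).restrict B).prod volume) := hρi.comp_snd _
    refine hi.bdd_mul (c := C + C) ?_ ?_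
    · refine Measurable.aestronglyMeasurable ?_
      exact (hm.comp (by fun_prop)).sub (hm.comp (by fun_prop))
    · exact Eventually.of_forall fun s => (norm_sub_le _ _).trans (add_le_add (hC _) (hC _))
  rw [integral_integral_swap (f := fun y s => (h (x + y - s) - h (x - s)) * ρ s) hF]
  refine integral_nonneg fun s => ?_
  simp only [Pi.zero_apply]
  rw [integral_mul_const]
  by_cases hs : ρ s = 0
  · simp [hs]
  refine mul_nonneg ?_ (φ.nonneg_normed _)
  have hs' : s ∈ ball (0 : Euc n) φ.rOut := by
    rw [← φ.support_normed_eq (μ := volume)]; exact hs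
  have hsn : ‖s‖ < φ.rOut := by simpa using hs'
  have hsub : closedBall (x - s) r ⊆ K := by
    refine Subset.trans ?_ hx
    refine closedBall_subset_closedBall' ?_
    have : dist (x - s) x = ‖s‖ := by simp [dist_eq_norm]
    linarith
  have hsm := hw.2 (x - s) ((hsub.trans hKΩ) (mem_closedBall_self hr.le)) r hr (hsub.trans hKΩ)
  rw [setAverage_eq, ball_translate, smul_eq_mul] at hsm
  have hreal : volume.real (ball (x - s) r) = volume.real B := by
    simp only [B, measureReal_def]
    rw [Measure.addHaar_ball_center]
  have hBpos : 0 < volume.real B := by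
    rw [measureReal_def]
    exact ENNReal.toReal_pos (measure_ball_pos volume _ hr).ne' measure_ball_lt_top.ne
  rw [hreal, ← div_eq_inv_mul, le_div_iff₀ hBpos] at hsm
  have e2 : ∫ y in B, (h (x + y - s) - h (x - s)) = ∫ y in B, (w (x - s + y) - w (x - s)) := by
    refine setIntegral_congr_fun measurableSet_ball fun y hy => ?_
    have hy' : ‖y‖ < r := by simpa [B] using hy
    have h1 : x + y - s ∈ K := by
      apply hsub; rw [mem_closedBall, dist_eq_norm]
      have : x + y - s - (x - s) = y := by abel
      rw [this]; exact hy'.le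
    have h2 : x - s ∈ K := hsub (mem_closedBall_self hr.le)
    have h3 : x - s + y = x + y - s := by abel
    simp only [hh, Set.indicator_of_mem h1, Set.indicator_of_mem h2, h3]
  rw [e2, integral_sub]
  · rw [setIntegral_const, smul_eq_mul]
    linarith
  · have hc : ContinuousOn (fun y => w (x - s + y)) (closedBall 0 r) := by
      refine hwK.comp (by fun_prop) ?_
      intro y hy
      apply hsub
      rw [mem_closedBall, dist_eq_norm]
      simpa using hy
    exact (hc.integrableOn_compact (isCompact_closedBall _ _)).mono_set ball_subset_closedBall
  · exact integrable_const _

theorem fderiv_reflect {n : ℕ} {ρ : Euc n → ℝ} (hρ : ContDiff ℝ (⊤ : ℕ∞) ρ) (x t e : Euc n) :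
    fderiv ℝ (fun t => ρ (x - t)) t e = - fderiv ℝ ρ (x - t) e := by
  have h1 : HasFDerivAt (fun t : Euc n => x - t) (-ContinuousLinearMap.id ℝ (Euc n)) t :=
    (hasFDerivAt_id t).const_sub x
  have h2 := ((hρ.differentiable (by simp) (x - t)).hasFDerivAt).comp t h1
  have h3 : fderiv ℝ (fun t => ρ (x - t)) t = _ := h2.fderiv
  rw [h3]; simp

theorem laplacian_reflect {n : ℕ} {ρ : Euc n → ℝ} (hρ : ContDiff ℝ (⊤ : ℕ∞) ρ) (x t : Euc n) :
    laplacian (fun t => ρ (x - t)) t = laplacian ρ (x - t) := by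
  unfold laplacian
  refine Finset.sum_congr rfl fun i _ => ?_
  simp only [fderiv_reflect hρ]
  rw [fderiv_fun_neg]
  have := fderiv_reflect (contDiff_dir hρ (EuclideanSpace.single i 1)) x t (EuclideanSpace.single i 1)
  simp only [ContinuousLinearMap.neg_apply]
  rw [this]; simp

theorem normed_smooth {n : ℕ} (φ : ContDiffBump (0 : Euc n)) :
    ContDiff ℝ (⊤ : ℕ∞) (φ.normed volume) := φ.contDiff_normed

theorem harmonic_cv {n : ℕ} {Ω K : Set (Euc n)} (hΩ : IsOpen Ω) (hKΩ : K ⊆ Ω) (hK : IsCompact K)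
    {u : Euc n → ℝ} (hu : HarmonicOn' u Ω) (φ : ContDiffBump (0 : Euc n)) {x : Euc n}
    (hx : closedBall x φ.rOut ⊆ K) :
    laplacian (cv (K.indicator u) (φ.normed volume)) x = 0 := by
  have huK : ContinuousOn u K := hu.1.continuousOn.mono hKΩ
  rw [laplacian_cv (ind_integrable hK huK).locallyIntegrable (normed_smooth φ)
    φ.hasCompactSupport_normed]
  have hz : ∀ t ∉ closedBall x φ.rOut, φ.normed volume (x - t) = 0 := by
    intro t ht
    by_contra h
    have : x - t ∈ Function.support (φ.normed (volume : Measure (Euc n))) := h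
    rw [φ.support_normed_eq] at this
    apply ht
    rw [mem_closedBall, dist_comm, dist_eq_norm]
    simpa using (mem_ball_zero_iff.1 this).le
  have hs : ContDiff ℝ (⊤ : ℕ∞) (fun t => φ.normed volume (x - t)) :=
    (normed_smooth φ).comp (contDiff_const.sub contDiff_id)
  have := integral_mul_laplacian_zero hΩ (isCompact_closedBall x φ.rOut) (hx.trans hKΩ) hu hs hz
  rw [← this]
  congr 1
  ext t
  rw [laplacian_reflect (normed_smooth φ)]
  by_cases ht : t ∈ closedBall x φ.rOut
  · rw [Set.indicator_of_mem (hx ht)]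
  · have := laplacian_zero_off isClosed_closedBall hz t ht
    rw [laplacian_reflect (normed_smooth φ)] at this
    simp [this]

theorem approx_cv {n : ℕ} {K K' : Set (Euc n)} (hK' : IsCompact K') {δ : ℝ} (hδ : 0 < δ)
    (hKK : ∀ x ∈ K, closedBall x δ ⊆ K') {g : Euc n → ℝ} (hg : ContinuousOn g K') {η : ℝ} (hη : 0 < η) :
    ∃ δ' > 0, ∀ φ : ContDiffBump (0 : Euc n), φ.rOut ≤ δ' → ∀ x ∈ K,
      |cv (K'.indicator g) (φ.normed volume) x - g x| ≤ η := by
  have huc := Metric.uniformContinuousOn_iff.1 (hK'.uniformContinuousOn_of_continuous hg) η hη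
  obtain ⟨δ₁, hδ₁, h1⟩ := huc
  refine ⟨min δ δ₁, lt_min hδ hδ₁, fun φ hφ x hx => ?_⟩
  have hxK : x ∈ K' := hKK x hx (mem_closedBall_self hδ.le)
  have := dist_cv_le φ (g := K'.indicator g) (x := x) (ε := η)
    (ind_measurable hK' hg).aestronglyMeasurable (by
      intro y hy
      have hy' : dist y x < min δ δ₁ := (mem_ball.1 hy).trans_le hφ
      have hyK : y ∈ K' := hKK x hx (hy'.le.trans (min_le_left _ _))
      rw [Set.indicator_of_mem hyK, Set.indicator_of_mem hxK]
      exact (h1 y hyK x hxK (hy'.trans_le (min_le_right _ _))).le)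
  rwa [Set.indicator_of_mem hxK, Real.dist_eq] at this

theorem laplacian_sub {n : ℕ} {f g : Euc n → ℝ} (hf : ContDiff ℝ (⊤ : ℕ∞) f)
    (hg : ContDiff ℝ (⊤ : ℕ∞) g) (x : Euc n) :
    laplacian (fun z => f z - g z) x = laplacian f x - laplacian g x := by
  unfold laplacian
  rw [← Finset.sum_sub_distrib]
  refine Finset.sum_congr rfl fun i _ => ?_
  have h1 : (fun z => fderiv ℝ (fun z => f z - g z) z (EuclideanSpace.single i 1)) =
      fun z => fderiv ℝ f z (EuclideanSpace.single i 1) - fderiv ℝ g z (EuclideanSpace.single i 1) := by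
    ext z
    rw [fderiv_fun_sub (hf.differentiable (by simp) z) (hg.differentiable (by simp) z)]; rfl
  rw [h1, fderiv_fun_sub ((contDiff_dir hf _).differentiable (by simp) x)
    ((contDiff_dir hg _).differentiable (by simp) x)]
  rfl

theorem smooth_approx {n : ℕ} {Ω K : Set (Euc n)} (hΩ : IsOpen Ω) (hK : IsCompact K) (hKΩ : K ⊆ Ω)
    {u w : Euc n → ℝ} (hu : HarmonicOn' u Ω) (hw : SubharmonicOn w Ω) {η : ℝ} (hη : 0 < η) :
    ∃ f : Euc n → ℝ, ContDiff ℝ (⊤ : ℕ∞) f ∧ (∀ x ∈ K, |f x - (w x - u x)| ≤ η) ∧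
      ∀ x ∈ K, 0 ≤ laplacian f x := by
  obtain ⟨δ, hδ, hsub⟩ := hK.exists_cthickening_subset_open hΩ hKΩ
  set K' := cthickening δ K
  have hK' : IsCompact K' := hK.cthickening
  have hKK : ∀ x ∈ K, closedBall x δ ⊆ K' := fun x hx => closedBall_subset_cthickening hx δ
  have huK : ContinuousOn u K' := hu.1.continuousOn.mono hsub
  have hwK : ContinuousOn w K' := hw.1.mono hsub
  obtain ⟨δu, hδu, hau⟩ := approx_cv hK' hδ hKK huK (half_pos hη)
  obtain ⟨δw, hδw, haw⟩ := approx_cv hK' hδ hKK hwK (half_pos hη)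
  set s := min (δ / 2) (min δu δw) with hs
  have hs0 : 0 < s := lt_min (half_pos hδ) (lt_min hδu hδw)
  let φ : ContDiffBump (0 : Euc n) := ⟨s / 2, s, half_pos hs0, half_lt_self hs0⟩
  have hφ : φ.rOut = s := rfl
  have hs1 : s ≤ δ / 2 := min_le_left _ _
  have hcu := cv_contDiff (ind_integrable hK' huK).locallyIntegrable (normed_smooth φ)
    φ.hasCompactSupport_normed
  have hcw := cv_contDiff (ind_integrable hK' hwK).locallyIntegrable (normed_smooth φ)
    φ.hasCompactSupport_normed
  refine ⟨fun z => cv (K'.indicator w) (φ.normed volume) z - cv (K'.indicator u) (φ.normed volume) z,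
    hcw.sub hcu, ?_, ?_⟩
  · intro x hx
    have a := hau φ ((min_le_right _ _).trans (min_le_left _ _)) x hx
    have b := haw φ ((min_le_right _ _).trans (min_le_right _ _)) x hx
    rw [abs_le] at *
    constructor <;> linarith [a.1, a.2, b.1, b.2]
  · intro x hx
    rw [laplacian_sub hcw hcu, harmonic_cv hΩ hsub hK' hu φ, sub_zero]
    · refine laplacian_nonneg_of_submean hcw x (half_pos hδ) fun r hr hr' => ?_
      refine submean_cv hK' hsub hw φ hr ?_
      refine (closedBall_subset_closedBall ?_).trans (hKK x hx)
      rw [hφ]; linarith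
    · refine (closedBall_subset_closedBall ?_).trans (hKK x hx)
      rw [hφ]; linarith

theorem green_key' {n : ℕ} {Ω K M : Set (Euc n)} (hΩ : IsOpen Ω) (hK : IsCompact K) (hKΩ : K ⊆ Ω)
    {x₀ : Euc n} (hM : IsCompact M) (hMΩ : M ⊆ Ω \ {x₀}) (hMK : M ⊆ K) {G : Euc n → ℝ}
    (hG1 : ContDiffOn ℝ (⊤ : ℕ∞) G (Ω \ {x₀}))
    (hG2 : ∀ x ∈ Ω \ {x₀}, 0 < G x)
    (hG3 : LocallyIntegrableOn G Ω volume)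
    (hG4 : ∀ φ : Euc n → ℝ, ContDiff ℝ (⊤ : ℕ∞) φ → HasCompactSupport φ → tsupport φ ⊆ Ω →
      ∫ x in Ω, G x * laplacian φ x = -(φ x₀))
    {ψ u w : Euc n → ℝ} (hψ : ContDiff ℝ (⊤ : ℕ∞) ψ) (hψ0 : ∀ x, 0 ≤ ψ x)
    (hψK : ∀ x ∉ K, ψ x = 0) (hψ1 : ψ x₀ = 1) (hψM : ∀ x ∉ M, fderiv ℝ ψ x = 0)
    (hu : HarmonicOn' u Ω) (hw : SubharmonicOn w Ω)
    (hnull : volume ({x₀} : Set (Euc n)) = 0) :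
    w x₀ - u x₀ ≤ ∫ x in M, |w x - u x| * |errD G ψ x| := by
  have hU : IsOpen (Ω \ {x₀}) := hΩ.sdiff isClosed_singleton
  have hEc := errD_continuous hU hM.isClosed hMΩ hG1 hψ hψM
  have hE0 := errD_zero_off (G := G) hM.isClosed hψM
  have hx₀K : x₀ ∈ K := by
    by_contra h
    rw [hψK x₀ h] at hψ1; norm_num at hψ1
  have hvM : ContinuousOn (fun x => w x - u x) M :=
    (hw.1.sub hu.1.continuousOn).mono (hMK.trans hKΩ)
  have i1 : IntegrableOn (fun x => |w x - u x| * |errD G ψ x|) M volume :=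
    (hvM.abs.mul hEc.abs.continuousOn).integrableOn_compact hM
  have i2 : IntegrableOn (fun x => |errD G ψ x|) M volume :=
    hEc.abs.continuousOn.integrableOn_compact hM
  set J := ∫ x in M, |errD G ψ x|
  have hJ : 0 ≤ J := integral_nonneg fun x => abs_nonneg _
  have main : ∀ η > 0, w x₀ - u x₀ ≤ (∫ x in M, |w x - u x| * |errD G ψ x|) + η * (J + 1) := by
    intro η hη
    obtain ⟨f, hf, hfa, hfl⟩ := smooth_approx hΩ hK hKΩ hu hw hη
    have h1 := green_key hΩ hK hKΩ hM hMΩ hG1 hG2 hG3 hG4 hψ hψ0 hψK hψ1 hψM hf hfl hnull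
    rw [← setIntegral_eq_integral_of_forall_compl_eq_zero (s := M)
      (fun x hx => by rw [hE0 x hx, mul_zero])] at h1
    have h2 : ∫ x in M, f x * errD G ψ x ≤ ∫ x in M, (|w x - u x| * |errD G ψ x| + η * |errD G ψ x|) := by
      refine setIntegral_mono_on ?_ (i1.add (i2.const_mul η)) hM.measurableSet ?_
      · exact (hf.continuous.mul hEc).continuousOn.integrableOn_compact hM
      · intro x hx
        have ha := hfa x (hMK hx)
        refine (le_abs_self _).trans ?_
        rw [abs_mul, ← add_mul]
        refine mul_le_mul_of_nonneg_right ?_ (abs_nonneg _)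
        have := abs_sub_abs_le_abs_sub (f x) (w x - u x)
        linarith
    rw [integral_add i1 (i2.const_mul η), integral_const_mul] at h2
    have h3 := hfa x₀ hx₀K
    rw [abs_le] at h3
    linarith [h3.1]
  refine le_of_forall_pos_le_add fun e he => ?_
  have := main (e / (J + 1)) (by positivity)
  rwa [div_mul_cancel₀ _ (by positivity)] at this


theorem scaled_cutoff (n : ℕ) : ∃ C : ℝ, 0 ≤ C ∧ ∀ (E : Set (Euc n)), MeasurableSet E → ∀ s : ℝ, 0 < s →
    ∃ ψ : Euc n → ℝ, ContDiff ℝ (⊤ : ℕ∞) ψ ∧ (∀ x, 0 ≤ ψ x) ∧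
      (∀ x, ball x s ⊆ E → ψ x = 1) ∧ (∀ x, (∀ y ∈ ball x s, y ∉ E) → ψ x = 0) ∧
      (∀ x i, |fderiv ℝ ψ x (EuclideanSpace.single i 1)| ≤ C / s) ∧
      (∀ x, |laplacian ψ x| ≤ C / s ^ 2) := by
  let φ : ContDiffBump (0 : Euc n) := ⟨1 / 2, 1, by norm_num, by norm_num⟩
  set ρ := φ.normed (volume : Measure (Euc n)) with hρd
  have hρ : ContDiff ℝ (⊤ : ℕ∞) ρ := normed_smooth φ
  have hρc : HasCompactSupport ρ := φ.hasCompactSupport_normed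
  let e : Fin n → Euc n := fun i => EuclideanSpace.single i 1
  let C1 : ℝ := ∑ i : Fin n, ∫ t, |fderiv ℝ ρ t (e i)|
  let C2 : ℝ := ∫ t, |laplacian ρ t|
  have hC1 : 0 ≤ C1 := Finset.sum_nonneg fun i _ => integral_nonneg fun t => abs_nonneg _
  have hC2 : 0 ≤ C2 := integral_nonneg fun t => abs_nonneg _
  refine ⟨C1 + C2, by positivity, fun E hE s hs => ?_⟩
  let E' : Set (Euc n) := {z | s • z ∈ E}
  have hE' : MeasurableSet E' := hE.preimage (by fun_prop : Measurable (fun z : Euc n => s • z))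
  let h : Euc n → ℝ := E'.indicator 1
  have hhm : Measurable h := measurable_one.indicator hE'
  have hb : ∀ z, |h z| ≤ 1 := by
    intro z
    by_cases hz : z ∈ E' <;> simp [h, hz]
  have hh : LocallyIntegrable h volume := by
    have h1 : LocallyIntegrable (fun _ : Euc n => (1:ℝ)) volume := locallyIntegrable_const 1
    exact h1.mono hhm.aestronglyMeasurable (Eventually.of_forall fun z => by simpa using hb z)
  have hbound : ∀ (k : Euc n → ℝ), Continuous k → HasCompactSupport k → ∀ x,
      |∫ t, h t * k (x - t)| ≤ ∫ t, |k t| := by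
    intro k hk hkc x
    have hki : Integrable k := hk.integrable_of_hasCompactSupport hkc
    have e1 : ∫ t, |k t| = ∫ t, |k (x - t)| :=
      (integral_sub_left_eq_self (fun t => |k t|) (volume : Measure (Euc n)) x).symm
    rw [e1]
    refine (abs_integral_le_integral_abs).trans ?_
    refine integral_mono_of_nonneg (Eventually.of_forall fun t => abs_nonneg _) ?_ ?_
    · exact (hki.comp_sub_left x).abs
    · refine Eventually.of_forall fun t => ?_
      simp only [abs_mul]
      exact mul_le_of_le_one_left (abs_nonneg _) (hb t)
  set g := cv h ρ with hgd
  have hg : ContDiff ℝ (⊤ : ℕ∞) g := cv_contDiff hh hρ hρc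
  have hg1 : ∀ x i, |fderiv ℝ g x (e i)| ≤ C1 := by
    intro x i
    rw [fderiv_cv hh hρ hρc]
    refine (hbound _ (contDiff_dir hρ _).continuous (compactSupport_dir hρc _) x).trans ?_
    exact Finset.single_le_sum (f := fun i => ∫ t, |fderiv ℝ ρ t (e i)|)
      (fun i _ => integral_nonneg fun t => abs_nonneg _) (Finset.mem_univ i)
  have hlc : HasCompactSupport (laplacian ρ) :=
    HasCompactSupport.intro hρc (fun x hx => laplacian_zero_off (isClosed_tsupport ρ)
      (fun y hy => image_eq_zero_of_notMem_tsupport hy) x hx)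
  have hg2 : ∀ x, |laplacian g x| ≤ C2 := by
    intro x
    rw [laplacian_cv hh hρ hρc]
    exact hbound _ (continuous_laplacian hρ) hlc x
  have hd : ∀ (k : Euc n → ℝ) x v, fderiv ℝ (fun z => k (s⁻¹ • z)) x v = s⁻¹ * fderiv ℝ k (s⁻¹ • x) v := by
    intro k x v
    rw [fderiv_comp_smul]; simp
  refine ⟨fun x => g (s⁻¹ • x), hg.comp (contDiff_const_smul _), ?_, ?_, ?_, ?_, ?_⟩
  · intro x
    refine integral_nonneg fun t => mul_nonneg ?_ (φ.nonneg_normed _)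
    by_cases hz : t ∈ E' <;> simp [h, hz]
  · intro x hx
    have hball : ∀ y ∈ ball (s⁻¹ • x) φ.rOut, h y = 1 := by
      intro y hy
      have : s • y ∈ E := by
        apply hx
        rw [mem_ball, dist_eq_norm] at hy ⊢
        have h1 : s • y - x = s • (y - s⁻¹ • x) := by rw [smul_sub, smul_inv_smul₀ hs.ne']
        rw [h1, norm_smul, Real.norm_of_nonneg hs.le]
        have : ‖y - s⁻¹ • x‖ < 1 := hy
        nlinarith
      have hyE : y ∈ E' := this
      simp [h, hyE]
    have h0 := hball _ (mem_ball_self φ.rOut_pos)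
    have := cv_eq_const φ (g := h) (x := s⁻¹ • x) (fun y hy => by rw [hball y hy, h0])
    simp only [hgd]
    rw [this, h0]
  · intro x hx
    have hball : ∀ y ∈ ball (s⁻¹ • x) φ.rOut, h y = 0 := by
      intro y hy
      have : s • y ∉ E := by
        apply hx
        rw [mem_ball, dist_eq_norm] at hy ⊢
        have h1 : s • y - x = s • (y - s⁻¹ • x) := by rw [smul_sub, smul_inv_smul₀ hs.ne']
        rw [h1, norm_smul, Real.norm_of_nonneg hs.le]
        have : ‖y - s⁻¹ • x‖ < 1 := hy
        nlinarith
      have hyE : y ∉ E' := this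
      simp [h, hyE]
    have h0 := hball _ (mem_ball_self φ.rOut_pos)
    have := cv_eq_const φ (g := h) (x := s⁻¹ • x) (fun y hy => by rw [hball y hy, h0])
    simp only [hgd]
    rw [this, h0]
  · intro x i
    rw [hd, abs_mul, abs_of_pos (inv_pos.2 hs), ← div_eq_inv_mul]
    gcongr
    exact (hg1 _ i).trans (by linarith)
  · intro x
    have : laplacian (fun x => g (s⁻¹ • x)) x = (s⁻¹)^2 * laplacian g (s⁻¹ • x) := by
      unfold laplacian
      rw [Finset.mul_sum]
      refine Finset.sum_congr rfl fun i _ => ?_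
      simp only [hd]
      rw [fderiv_const_mul]
      · simp only [smul_apply, smul_eq_mul]
        rw [hd (fun z => fderiv ℝ g z (EuclideanSpace.single i 1))]
        ring
      · have : ContDiff ℝ (⊤ : ℕ∞) (fun z => fderiv ℝ g (s⁻¹ • z) (EuclideanSpace.single i (1:ℝ))) :=
          (contDiff_dir hg _).comp (contDiff_const_smul _)
        exact this.differentiable (by simp) x
    rw [this, abs_mul, abs_of_nonneg (by positivity), inv_pow, ← div_eq_inv_mul]
    gcongr
    exact (hg2 _).trans (by linarith)

theorem meets_frontier {n : ℕ} {Ω s : Set (Euc n)} (hs : IsPreconnected s) {x y : Euc n}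
    (hx : x ∈ s) (hxΩ : x ∈ Ω) (hy : y ∈ s) (hyΩ : y ∉ Ω) : ∃ z ∈ s, z ∈ frontier Ω := by
  by_contra hcon
  push Not at hcon
  have h := hs (interior Ω) (closure Ω)ᶜ isOpen_interior isClosed_closure.isOpen_compl ?_ ?_ ?_
  · obtain ⟨z, _, hz1, hz2⟩ := h
    exact hz2 (subset_closure (interior_subset hz1))
  · intro z hz
    by_contra h'
    simp only [Set.mem_union, Set.mem_compl_iff, not_or, not_not] at h'
    exact hcon z hz ⟨h'.2, h'.1⟩
  · refine ⟨x, hx, ?_⟩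
    by_contra h'
    exact hcon x hx ⟨subset_closure hxΩ, h'⟩
  · refine ⟨y, hy, fun h' => ?_⟩
    exact hcon y hy ⟨h', fun h'' => hyΩ (interior_subset h'')⟩

theorem ball_subset_of_infDist {n : ℕ} {Ω : Set (Euc n)} {x : Euc n} (hx : x ∈ Ω) {r : ℝ}
    (hr : r ≤ infDist x (frontier Ω)) : ball x r ⊆ Ω := by
  by_contra hcon
  obtain ⟨y, hy, hyΩ⟩ := Set.not_subset.1 hcon
  have hpre : IsPreconnected (ball x r) := (convex_ball x r).isPreconnected
  have hxr : x ∈ ball x r := mem_ball_self (lt_of_le_of_lt dist_nonneg (mem_ball.1 hy))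
  obtain ⟨z, hz, hzf⟩ := meets_frontier hpre hxr hx hy hyΩ
  have := infDist_le_dist_of_mem (x := x) hzf
  rw [mem_ball, dist_comm] at hz
  linarith

/-- The layer at distance between `a` and `b`. -/
def lay {n : ℕ} (Ω : Set (Euc n)) (a b : ℝ) : Set (Euc n) :=
  {y | y ∈ Ω ∧ a ≤ infDist y (frontier Ω) ∧ infDist y (frontier Ω) ≤ b}

/-- The inner region at distance at least `a`. -/
def inn {n : ℕ} (Ω : Set (Euc n)) (a : ℝ) : Set (Euc n) :=
  {y | y ∈ Ω ∧ a ≤ infDist y (frontier Ω)}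

theorem inn_compact {n : ℕ} {Ω : Set (Euc n)} (hΩ : IsOpen Ω) (hb : Bornology.IsBounded Ω) {a : ℝ} (ha : 0 < a) :
    IsCompact (inn Ω a) := by
  have : inn Ω a = closure Ω ∩ {y | a ≤ infDist y (frontier Ω)} := by
    ext y
    constructor
    · rintro ⟨h1, h2⟩; exact ⟨subset_closure h1, h2⟩
    · rintro ⟨h1, h2⟩
      refine ⟨?_, h2⟩
      by_contra h
      have hy : y ∈ frontier Ω := by rw [hΩ.frontier_eq]; exact ⟨h1, h⟩
      have := infDist_zero_of_mem hy
      simp only [mem_setOf_eq] at h2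
      linarith
  rw [this]
  exact hb.isCompact_closure.inter_right (isClosed_le continuous_const (continuous_infDist_pt _))

theorem lay_compact {n : ℕ} {Ω : Set (Euc n)} (hΩ : IsOpen Ω) (hb : Bornology.IsBounded Ω) {a b : ℝ} (ha : 0 < a) :
    IsCompact (lay Ω a b) := by
  have : lay Ω a b = inn Ω a ∩ {y | infDist y (frontier Ω) ≤ b} := by
    ext y
    exact ⟨fun h => ⟨⟨h.1, h.2.1⟩, h.2.2⟩, fun h => ⟨h.1.1, h.1.2, h.2⟩⟩
  rw [this]
  exact (inn_compact hΩ hb ha).inter_right (isClosed_le (continuous_infDist_pt _) continuous_const)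

theorem cutoff (n : ℕ) : ∃ C : ℝ, 0 ≤ C ∧ ∀ (Ω : Set (Euc n)), IsOpen Ω → Bornology.IsBounded Ω →
    ∀ ε : ℝ, 0 < ε →
    ∃ ψ : Euc n → ℝ, ContDiff ℝ (⊤ : ℕ∞) ψ ∧ (∀ x, 0 ≤ ψ x) ∧
      (∀ x ∉ inn Ω (ε / 4), ψ x = 0) ∧ (∀ x ∈ Ω, 3 * ε / 4 < infDist x (frontier Ω) → ψ x = 1) ∧
      (∀ x ∉ lay Ω (ε / 4) (3 * ε / 4), fderiv ℝ ψ x = 0) ∧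
      (∀ x i, |fderiv ℝ ψ x (EuclideanSpace.single i 1)| ≤ C / ε) ∧
      (∀ x, |laplacian ψ x| ≤ C / ε ^ 2) := by
  obtain ⟨C, hC, h⟩ := scaled_cutoff n
  refine ⟨16 * C, by positivity, fun Ω hΩ hb ε hε => ?_⟩
  have hEm : MeasurableSet {y | y ∈ Ω ∧ ε / 2 < infDist y (frontier Ω)} :=
    (hΩ.inter (isOpen_lt continuous_const (continuous_infDist_pt _))).measurableSet
  obtain ⟨ψ, h1, h2, h3, h4, h5, h6⟩ := h _ hEm (ε / 4) (by positivity)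
  have hz : ∀ x ∉ inn Ω (ε / 4), ψ x = 0 := by
    intro x hx
    refine h4 x fun y hy hyE => hx ?_
    have hd := infDist_le_infDist_add_dist (s := frontier Ω) (x := y) (y := x)
    have hy' := mem_ball.1 hy
    have hyE2 := hyE.2
    refine ⟨ball_subset_of_infDist hyE.1 (r := ε / 2) hyE2.le ?_, by linarith⟩
    rw [mem_ball, dist_comm]; linarith
  have ho : ∀ x ∈ Ω, 3 * ε / 4 < infDist x (frontier Ω) → ψ x = 1 := by
    intro x hx hxd
    refine h3 x fun y hy => ?_
    have hd := infDist_le_infDist_add_dist (s := frontier Ω) (x := x) (y := y)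
    have hy' := mem_ball.1 hy
    rw [dist_comm] at hy'
    refine ⟨ball_subset_of_infDist hx (r := 3 * ε / 4) hxd.le ?_, by linarith⟩
    rw [mem_ball, dist_comm]; linarith
  refine ⟨ψ, h1, h2, hz, ho, ?_, ?_, ?_⟩
  · intro x hx
    by_cases hxi : x ∈ inn Ω (ε / 4)
    · have hxd : 3 * ε / 4 < infDist x (frontier Ω) := by
        by_contra hcon
        exact hx ⟨hxi.1, hxi.2, not_lt.1 hcon⟩
      have : ψ =ᶠ[𝓝 x] fun _ => 1 := by
        filter_upwards [hΩ.mem_nhds hxi.1,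
          (isOpen_lt continuous_const (continuous_infDist_pt (frontier Ω))).mem_nhds hxd] with y hy hy'
        exact ho y hy hy'
      rw [this.fderiv_eq]; simp
    · exact fderiv_zero_off (inn_compact hΩ hb (by positivity)).isClosed hz x hxi
  · intro x i
    refine (h5 x i).trans ?_
    rw [div_div_eq_mul_div]
    exact div_le_div_of_nonneg_right (by linarith) hε.le
  · intro x
    refine (h6 x).trans (le_of_eq ?_)
    field_simp
    ring


theorem ray_hits {n : ℕ} {Ω : Set (Euc n)} (hΩ : IsOpen Ω) (hb : Bornology.IsBounded Ω) {x e : Euc n}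
    (hx : x ∈ Ω) (he : e ≠ 0) : ∃ t : ℝ, 0 < t ∧ x + t • e ∈ frontier Ω := by
  have hpre : IsPreconnected ((fun t : ℝ => x + t • e) '' Ici 0) :=
    isPreconnected_Ici.image _ (by fun_prop)
  obtain ⟨R, hR⟩ := hb.subset_closedBall x
  have he' : 0 < ‖e‖ := norm_pos_iff.2 he
  set t₁ : ℝ := (|R| + 1) / ‖e‖ with ht₁
  have ht₁0 : 0 < t₁ := by positivity
  have hy : x + t₁ • e ∉ Ω := by
    intro h
    have := hR h
    rw [mem_closedBall, dist_eq_norm, add_sub_cancel_left, norm_smul, Real.norm_of_nonneg ht₁0.le, ht₁,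
      div_mul_cancel₀ _ he'.ne'] at this
    have := le_abs_self R
    linarith
  obtain ⟨z, ⟨t, ht, rfl⟩, hz⟩ := meets_frontier hpre (x := x) ⟨0, by simp, by simp⟩ hx
    ⟨t₁, ht₁0.le, rfl⟩ hy
  refine ⟨t, lt_of_le_of_ne ht ?_, hz⟩
  rintro rfl
  rw [hΩ.frontier_eq] at hz
  simp at hz
  exact hz.2 hx

theorem frontier_nontrivial {n : ℕ} (hn : 2 ≤ n) {Ω : Set (Euc n)} (hΩ : IsOpen Ω) (hb : Bornology.IsBounded Ω)
    (hne : Ω.Nonempty) : (frontier Ω).Nontrivial := by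
  obtain ⟨x, hx⟩ := hne
  have he : (EuclideanSpace.single (⟨0, by omega⟩ : Fin n) (1:ℝ)) ≠ 0 := by
    intro h
    have := congrArg norm h
    simp at this
  obtain ⟨t, ht, h1⟩ := ray_hits hΩ hb hx he
  obtain ⟨s, hs, h2⟩ := ray_hits hΩ hb hx (neg_ne_zero.2 he)
  refine ⟨_, h1, _, h2, fun h => ?_⟩
  have h3 := add_left_cancel h
  have h4 : (t + s) • (EuclideanSpace.single (⟨0, by omega⟩ : Fin n) (1:ℝ)) = 0 := by
    rw [add_smul, h3]; simp
  rcases smul_eq_zero.1 h4 with h5 | h5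
  · linarith
  · exact he h5

theorem frontier_bounded {n : ℕ} {Ω : Set (Euc n)} (hb : Bornology.IsBounded Ω) :
    Bornology.IsBounded (frontier Ω) := hb.closure.subset frontier_subset_closure

theorem sigma_finite' {n : ℕ} (hn : 2 ≤ n) {Ω : Set (Euc n)} (hΩ : IsOpen Ω) (hb : Bornology.IsBounded Ω)
    (hne : Ω.Nonempty) {C₀ : ℝ} (hAR : AhlforsRegularWith n (frontier Ω) C₀) :
    IsFiniteMeasure ((μH[(n : ℝ) - 1] : Measure (Euc n)).restrict (frontier Ω)) := by
  have hnt := frontier_nontrivial hn hΩ hb hne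
  have hfb := frontier_bounded hb
  have hD : EMetric.diam (frontier Ω) ≠ ⊤ := hfb.ediam_ne_top
  have hD0 : 0 < Metric.diam (frontier Ω) := by
    rw [Metric.diam]
    exact ENNReal.toReal_pos (Metric.ediam_pos_iff.2 hnt).ne' hD
  obtain ⟨x, hx⟩ := hnt.nonempty
  refine ⟨?_⟩
  rw [Measure.restrict_apply_univ]
  have h := (hAR.2.2 x hx (3 / 2 * Metric.diam (frontier Ω)) (by positivity) ?_).2
  · have hsub : frontier Ω ⊆ frontier Ω ∩ ball x (3 / 2 * Metric.diam (frontier Ω)) := ?_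
    · exact lt_of_le_of_lt (measure_mono hsub) (lt_of_le_of_lt h ENNReal.ofReal_lt_top)
    intro y hy
    refine ⟨hy, ?_⟩
    have := Metric.dist_le_diam_of_mem hfb hy hx
    rw [mem_ball]; linarith
  · have : EMetric.diam (frontier Ω) = ENNReal.ofReal (Metric.diam (frontier Ω)) :=
      (ENNReal.ofReal_toReal hD).symm
    have h22 : ∀ z : ℝ≥0∞, 2 * z = ENNReal.ofReal 2 * z := fun z => by simp
    rw [this, h22, ← ENNReal.ofReal_mul (by norm_num)]
    exact (ENNReal.ofReal_lt_ofReal_iff (by positivity)).2 (by linarith)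

theorem isOpen_nt_prod {n : ℕ} {Ω : Set (Euc n)} (hΩ : IsOpen Ω) (κ : ℝ) :
    IsOpen {q : Euc n × Euc n | q.1 ∈ ntRegion Ω κ q.2} := by
  have h1 : IsOpen {q : Euc n × Euc n | q.1 ∈ Ω} := hΩ.preimage continuous_fst
  have h2 : IsOpen {q : Euc n × Euc n | dist q.2 q.1 < (1 + κ) * infDist q.1 (frontier Ω)} :=
    isOpen_lt (by fun_prop) (continuous_const.mul ((continuous_infDist_pt _).comp continuous_fst))
  exact h1.inter h2

theorem isOpen_ntRegion {n : ℕ} {Ω : Set (Euc n)} (hΩ : IsOpen Ω) (κ : ℝ) (x : Euc n) :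
    IsOpen (ntRegion Ω κ x) :=
  (isOpen_nt_prod hΩ κ).preimage (by fun_prop : Continuous fun y : Euc n => (y, x))

theorem isOpen_collar {n : ℕ} {Ω : Set (Euc n)} (hΩ : IsOpen Ω) (ε : ℝ) :
    IsOpen (collar Ω ε) :=
  hΩ.inter (isOpen_lt (continuous_infDist_pt _) continuous_const)

theorem layer {n : ℕ} (hn : 2 ≤ n) {Ω : Set (Euc n)} (hΩ : IsOpen Ω) (hb : Bornology.IsBounded Ω)
    (hne : Ω.Nonempty) {C₀ : ℝ} (hAR : AhlforsRegularWith n (frontier Ω) C₀)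
    {σ : Measure (Euc n)} (hσ : σ = (μH[(n : ℝ) - 1]).restrict (frontier Ω))
    {κ : ℝ} (hκ : 0 < κ) :
    ∃ C r₁ : ℝ, 0 ≤ C ∧ 0 < r₁ ∧ ∀ ε, 0 < ε → ε < r₁ → ∀ H N : Euc n → ℝ≥0∞,
      AEMeasurable H (volume.restrict (lay Ω (ε / 4) (3 * ε / 4))) →
      (∀ᵐ x ∂σ, ∀ᵐ y ∂volume.restrict (ntRegion Ω κ x ∩ collar Ω ε), H y ≤ N x) →
      ∫⁻ y in lay Ω (ε / 4) (3 * ε / 4), H y ≤ ENNReal.ofReal (C * ε) * ∫⁻ x, N x ∂σ := by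
  have hnt := frontier_nontrivial hn hΩ hb hne
  have hfb := frontier_bounded hb
  have hD : EMetric.diam (frontier Ω) ≠ ⊤ := hfb.ediam_ne_top
  have hD0 : 0 < Metric.diam (frontier Ω) := by
    rw [Metric.diam]
    exact ENNReal.toReal_pos (Metric.ediam_pos_iff.2 hnt).ne' hD
  have hDe : EMetric.diam (frontier Ω) = ENNReal.ofReal (Metric.diam (frontier Ω)) :=
      (ENNReal.ofReal_toReal hD).symm
  have : IsFiniteMeasure σ := hσ ▸ sigma_finite' hn hΩ hb hne hAR
  have hC0 : 1 < C₀ := hAR.1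
  set V : ℝ := (volume (ball (0 : Euc n) 1)).toReal with hV
  set D := Metric.diam (frontier Ω) with hDdef
  refine ⟨C₀ * (1 + κ) ^ n * V * (4 / κ) ^ (n - 1), D / κ, by positivity, by positivity, ?_⟩
  intro ε hε hεr H N hH hHN
  set S := lay Ω (ε / 4) (3 * ε / 4) with hS
  have hSm : MeasurableSet S := (lay_compact hΩ hb (by positivity)).isClosed.measurableSet
  set c : ℝ := C₀⁻¹ * (κ * ε / 4) ^ (n - 1) with hc
  have hc0 : 0 < c := by positivity
  have hσc : ∀ y ∈ S, ENNReal.ofReal c ≤ σ {x | y ∈ ntRegion Ω κ x} := by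
    intro y hy
    obtain ⟨z, hz, hzd⟩ := isClosed_frontier.exists_infDist_eq_dist hnt.nonempty y
    have h := (hAR.2.2 z hz (κ * ε / 4) (by positivity) ?_).1
    · refine h.trans ?_
      rw [hσ, Measure.restrict_apply]
      · refine measure_mono fun x hx => ⟨⟨hy.1, ?_⟩, hx.1⟩
        have h1 := mem_ball.1 hx.2
        have h2 := dist_triangle x z y
        rw [dist_comm z y, ← hzd] at h2
        have h3 := hy.2.1
        nlinarith
      · exact ((isOpen_nt_prod hΩ κ).preimage (by fun_prop : Continuous fun x : Euc n => (y, x))).measurableSet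
    · have h22 : ∀ z : ℝ≥0∞, 2 * z = ENNReal.ofReal 2 * z := fun z => by simp
      rw [hDe, h22, ← ENNReal.ofReal_mul (by norm_num)]
      refine (ENNReal.ofReal_lt_ofReal_iff (by positivity)).2 ?_
      rw [lt_div_iff₀ hκ] at hεr
      nlinarith
  set T : Set (Euc n × Euc n) := {q | q.1 ∈ ntRegion Ω κ q.2} with hT
  have hTm : MeasurableSet T := (isOpen_nt_prod hΩ κ).measurableSet
  set F : Euc n → Euc n → ℝ≥0∞ := fun y x => T.indicator (fun q => H q.1) (y, x) with hF
  have hFm : AEMeasurable (Function.uncurry F) ((volume.restrict S).prod σ) := by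
    have : Function.uncurry F = T.indicator (fun q => H q.1) := by
      ext q; rfl
    rw [this]
    exact (hH.comp_fst).indicator hTm
  have h1 : ENNReal.ofReal c * ∫⁻ y in S, H y ≤ ∫⁻ y in S, ∫⁻ x, F y x ∂σ := by
    rw [← lintegral_const_mul' _ _ ENNReal.ofReal_ne_top]
    refine setLIntegral_mono' hSm fun y hy => ?_
    have : ∀ x, F y x = {x | y ∈ ntRegion Ω κ x}.indicator (fun _ => H y) x := fun x => rfl
    simp only [this]
    rw [lintegral_indicator_const, mul_comm]
    · gcongr; exact hσc y hy
    · exact ((isOpen_nt_prod hΩ κ).preimage (by fun_prop : Continuous fun x : Euc n => (y, x))).measurableSet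
  rw [lintegral_lintegral_swap hFm] at h1
  have h2 : ∫⁻ x, (∫⁻ y in S, F y x) ∂σ ≤ ENNReal.ofReal (((1 + κ) * ε) ^ n * V) * ∫⁻ x, N x ∂σ := by
    rw [← lintegral_const_mul' _ _ ENNReal.ofReal_ne_top]
    refine lintegral_mono_ae ?_
    filter_upwards [hHN] with x hx
    have hsub : S ⊆ collar Ω ε := fun y hy => ⟨hy.1, by have := hy.2.2; linarith⟩
    have hΓm : MeasurableSet (ntRegion Ω κ x) := (isOpen_ntRegion hΩ κ x).measurableSet
    calc ∫⁻ y in S, F y x ≤ ∫⁻ y in collar Ω ε, F y x := lintegral_mono_set hsub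
      _ = ∫⁻ y in collar Ω ε, (ntRegion Ω κ x).indicator H y := rfl
      _ = ∫⁻ y in ntRegion Ω κ x ∩ collar Ω ε, H y := setLIntegral_indicator hΓm _
      _ ≤ ∫⁻ y in ntRegion Ω κ x ∩ collar Ω ε, N x := lintegral_mono_ae hx
      _ = N x * volume (ntRegion Ω κ x ∩ collar Ω ε) := by
        rw [lintegral_const, Measure.restrict_apply_univ]
      _ ≤ N x * volume (ball x ((1 + κ) * ε)) := by
        gcongr
        rintro y ⟨hy1, hy2⟩
        rw [mem_ball, dist_comm]
        refine hy1.2.trans ?_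
        have := hy2.2
        gcongr
      _ = _ := by
        rw [mul_comm, Measure.addHaar_ball_of_pos _ _ (by positivity), ENNReal.ofReal_mul (by positivity), hV,
          ENNReal.ofReal_toReal measure_ball_lt_top.ne]
        simp
  have h3 : ((1 + κ) * ε) ^ n * V = c * (C₀ * (1 + κ) ^ n * V * (4 / κ) ^ (n - 1) * ε) := by
    obtain ⟨m, rfl⟩ : ∃ m, n = m + 1 := ⟨n - 1, by omega⟩
    simp only [hc, Nat.add_sub_cancel]
    rw [mul_pow, div_pow, mul_pow, div_pow, pow_succ ε]
    field_simp
  have h4 := h1.trans h2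
  rw [h3, ENNReal.ofReal_mul hc0.le, mul_assoc] at h4
  exact (ENNReal.mul_le_mul_iff_right (by simpa using hc0) ENNReal.ofReal_ne_top).1 h4


theorem essSup_le_iff' {α : Type*} [MeasurableSpace α] {μ : Measure α} {f : α → ℝ≥0∞} {t : ℝ≥0∞} :
    essSup f μ ≤ t ↔ ∀ᵐ y ∂μ, f y ≤ t := by
  constructor
  · intro h
    filter_upwards [ENNReal.ae_le_essSup (μ := μ) f] with y hy
    exact hy.trans h
  · intro h
    exact essSup_le_of_ae_le t h

theorem measurable_ntMaxOn {n : ℕ} {E : Type*} [NormedAddCommGroup E] {Ω S : Set (Euc n)} (hΩ : IsOpen Ω)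
    (hS : IsOpen S) (κ : ℝ) (u : Euc n → E) : Measurable (ntMaxOn Ω S κ u) := by
  refine measurable_of_Iic fun t => ?_
  rw [← MeasurableSet.compl_iff]
  refine IsOpen.measurableSet ?_
  set B : Set (Euc n) := {y | ¬ ((‖u y‖₊ : ℝ≥0∞) ≤ t)} with hB
  have key : ∀ x, x ∈ (ntMaxOn Ω S κ u ⁻¹' Iic t)ᶜ ↔ volume (B ∩ (ntRegion Ω κ x ∩ S)) ≠ 0 := by
    intro x
    have hm : MeasurableSet (ntRegion Ω κ x ∩ S) := ((isOpen_ntRegion hΩ κ x).inter hS).measurableSet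
    rw [Set.mem_compl_iff, Set.mem_preimage, Set.mem_Iic, ntMaxOn, essSup_le_iff', ae_iff,
      Measure.restrict_apply' hm]
  rw [Metric.isOpen_iff]
  intro x hx
  rw [key] at hx
  set R : ℕ → Set (Euc n) := fun k => {y | y ∈ Ω ∧ dist x y + 1 / ((k : ℝ) + 1) < (1 + κ) * infDist y (frontier Ω)}
  have hex : ∃ k, volume (B ∩ (R k ∩ S)) ≠ 0 := by
    by_contra hcon
    push Not at hcon
    refine hx (measure_mono_null ?_ (measure_iUnion_null hcon))
    rintro y ⟨hy1, hy2, hy3⟩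
    obtain ⟨k, hk⟩ := exists_nat_one_div_lt (sub_pos.2 hy2.2)
    exact mem_iUnion.2 ⟨k, hy1, ⟨hy2.1, by linarith⟩, hy3⟩
  obtain ⟨k, hk⟩ := hex
  refine ⟨1 / ((k : ℝ) + 1), by positivity, fun x' hx' => ?_⟩
  rw [key]
  refine fun h0 => hk (measure_mono_null ?_ h0)
  rintro y ⟨hy1, hy2, hy3⟩
  refine ⟨hy1, ⟨hy2.1, ?_⟩, hy3⟩
  have h1 := dist_triangle x' x y
  have h2 := mem_ball.1 hx'
  have h3 := hy2.2
  linarith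

theorem ntMax_eq {n : ℕ} {E : Type*} [NormedAddCommGroup E] {Ω : Set (Euc n)} (κ : ℝ) (u : Euc n → E) :
    ntMax Ω κ u = ntMaxOn Ω univ κ u := by
  ext x
  rw [ntMax, ntMaxOn, inter_univ]

theorem measurable_ntMax {n : ℕ} {E : Type*} [NormedAddCommGroup E] {Ω : Set (Euc n)} (hΩ : IsOpen Ω)
    (κ : ℝ) (u : Euc n → E) : Measurable (ntMax Ω κ u) := by
  rw [ntMax_eq]
  exact measurable_ntMaxOn hΩ isOpen_univ κ u

theorem ntMaxOn_sub_le {n : ℕ} {Ω S : Set (Euc n)} (κ : ℝ) (u w : Euc n → ℝ) (x : Euc n) :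
    ntMaxOn Ω S κ (fun y => w y - u y) x ≤ ntMax Ω κ u x + ntMax Ω κ w x := by
  rw [ntMaxOn, essSup_le_iff']
  refine ae_restrict_of_ae_restrict_of_subset (t := ntRegion Ω κ x) inter_subset_left ?_
  filter_upwards [ENNReal.ae_le_essSup (μ := volume.restrict (ntRegion Ω κ x)) (fun y => (‖u y‖₊ : ℝ≥0∞)),
    ENNReal.ae_le_essSup (μ := volume.restrict (ntRegion Ω κ x)) (fun y => (‖w y‖₊ : ℝ≥0∞))] with y h1 h2
  calc (‖w y - u y‖₊ : ℝ≥0∞) ≤ ((‖w y‖₊ + ‖u y‖₊ : ℝ≥0) : ℝ≥0∞) := by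
        exact_mod_cast nnnorm_sub_le _ _
    _ = ‖u y‖₊ + ‖w y‖₊ := by push_cast; rw [add_comm]
    _ ≤ _ := add_le_add h1 h2

theorem ntMaxOn_tendsto {n : ℕ} {Ω : Set (Euc n)} (hΩ : IsOpen Ω) {κ : ℝ} (hκ : 0 < κ) {u w : Euc n → ℝ} {x : Euc n} {f : ℝ}
    (hu : HasNTTrace Ω κ u x f) (hw : HasNTTrace Ω κ w x f) :
    Tendsto (fun ε : ℝ => ntMaxOn Ω (collar Ω ε) κ (fun y => w y - u y) x) (𝓝[>] 0) (𝓝 0) := by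
  obtain ⟨-, N₁, -, hN₁, h₁⟩ := hu
  obtain ⟨-, N₂, -, hN₂, h₂⟩ := hw
  rw [ENNReal.tendsto_nhds_zero]
  intro δ' hδ'
  obtain ⟨δ, hδ0, hδ⟩ : ∃ δ : ℝ, 0 < δ ∧ ENNReal.ofReal δ ≤ δ' := by
    obtain ⟨δ, h1, h2⟩ := ENNReal.lt_iff_exists_nnreal_btwn.1 hδ'
    refine ⟨δ, by exact_mod_cast h1, by rw [ENNReal.ofReal_coe_nnreal]; exact h2.le⟩
  have hu' := h₁ (Metric.ball_mem_nhds f (half_pos hδ0))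
  have hw' := h₂ (Metric.ball_mem_nhds f (half_pos hδ0))
  rw [Filter.mem_map, Metric.mem_nhdsWithin_iff] at hu' hw'
  obtain ⟨r₁, hr₁, hu'⟩ := hu'
  obtain ⟨r₂, hr₂, hw'⟩ := hw'
  have hev : ∀ᶠ ε : ℝ in 𝓝[>] 0, ε < min r₁ r₂ / (1 + κ) :=
    (eventually_lt_nhds (by positivity)).filter_mono nhdsWithin_le_nhds
  filter_upwards [hev] with ε hε
  refine le_trans ?_ hδ
  have hm : MeasurableSet (ntRegion Ω κ x ∩ collar Ω ε) :=
    ((isOpen_ntRegion hΩ κ x).inter (isOpen_collar hΩ ε)).measurableSet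
  rw [ntMaxOn, essSup_le_iff', ae_restrict_iff' hm]
  have a1 : ∀ᵐ y ∂(volume : Measure (Euc n)), y ∉ N₁ := measure_eq_zero_iff_ae_notMem.1 hN₁
  have a2 : ∀ᵐ y ∂(volume : Measure (Euc n)), y ∉ N₂ := measure_eq_zero_iff_ae_notMem.1 hN₂
  filter_upwards [a1, a2] with y hy1 hy2 hy
  have hd : dist y x < min r₁ r₂ := by
    rw [dist_comm]
    refine hy.1.2.trans ?_
    rw [lt_div_iff₀ (by positivity)] at hε
    have := hy.2.2
    nlinarith
  have b1 := hu' ⟨mem_ball.2 (hd.trans_le (min_le_left _ _)), hy.1, hy1⟩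
  have b2 := hw' ⟨mem_ball.2 (hd.trans_le (min_le_right _ _)), hy.1, hy2⟩
  rw [Set.mem_preimage, mem_ball] at b1 b2
  have b3 : ‖w y - u y‖ ≤ δ := by
    rw [← dist_eq_norm]
    have := dist_triangle_right (w y) (u y) f
    linarith
  rw [← ENNReal.ofReal_coe_nnreal]
  exact ENNReal.ofReal_le_ofReal b3

theorem lp_tendsto {n : ℕ} {Ω : Set (Euc n)} (hΩ : IsOpen Ω) {κ : ℝ} (hκ : 0 < κ) {u w : Euc n → ℝ}
    {σ : Measure (Euc n)} {p : ℝ} (hp : 1 < p)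
    (hNu : ∫⁻ x, (ntMax Ω κ u x) ^ p ∂σ < ⊤) (hNw : ∫⁻ x, (ntMax Ω κ w x) ^ p ∂σ < ⊤)
    (htr : ∀ᵐ x ∂σ, ∃ f : ℝ, HasNTTrace Ω κ u x f ∧ HasNTTrace Ω κ w x f) :
    Tendsto (fun ε : ℝ => (∫⁻ x, (ntMaxOn Ω (collar Ω ε) κ (fun y => w y - u y) x) ^ p ∂σ) ^ (1 / p))
      (𝓝[>] 0) (𝓝 0) := by
  have h := tendsto_lintegral_filter_of_dominated_convergence (μ := σ) (l := 𝓝[>] (0:ℝ))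
    (F := fun ε x => (ntMaxOn Ω (collar Ω ε) κ (fun y => w y - u y) x) ^ p) (f := fun _ => 0)
    (fun x => (ntMax Ω κ u x + ntMax Ω κ w x) ^ p) ?_ ?_ ?_ ?_
  · rw [lintegral_zero] at h
    have h2 := h.ennrpow_const (1 / p)
    rwa [ENNReal.zero_rpow_of_pos (by positivity)] at h2
  · exact Eventually.of_forall fun ε => (measurable_ntMaxOn hΩ (isOpen_collar hΩ ε) κ _).pow_const p
  · refine Eventually.of_forall fun ε => Eventually.of_forall fun x => ?_
    exact ENNReal.rpow_le_rpow (ntMaxOn_sub_le κ u w x) (by linarith)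
  · exact (ENNReal.lintegral_rpow_add_lt_top_of_lintegral_rpow_lt_top
      (measurable_ntMax hΩ κ u).aemeasurable hNu hNw hp.le).ne
  · filter_upwards [htr] with x hx
    obtain ⟨f, h1, h2⟩ := hx
    have h3 := (ntMaxOn_tendsto hΩ hκ h1 h2).ennrpow_const p
    rwa [ENNReal.zero_rpow_of_pos (by linarith)] at h3

theorem errD_bound {n : ℕ} {G ψ : Euc n → ℝ} {C ε : ℝ} (hC : 0 ≤ C) (hε : 0 < ε) {x : Euc n}
    (h1 : ∀ i, |fderiv ℝ ψ x (EuclideanSpace.single i 1)| ≤ C / ε)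
    (h2 : |laplacian ψ x| ≤ C / ε ^ 2) :
    |errD G ψ x| ≤ 2 * n * C / ε * ‖gradient G x‖ + C / ε ^ 2 * ‖G x‖ := by
  have hg : ‖gradient G x‖ = ‖fderiv ℝ G x‖ := by
    rw [gradient, LinearIsometryEquiv.norm_map]
  have hi : ∀ i, |fderiv ℝ G x (EuclideanSpace.single i 1)| ≤ ‖gradient G x‖ := by
    intro i
    have := (fderiv ℝ G x).le_opNorm (EuclideanSpace.single i (1:ℝ))
    simpa [hg] using this
  unfold errD
  refine (abs_add_le _ _).trans ?_
  refine add_le_add ?_ ?_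
  · rw [abs_mul, abs_two]
    have : |∑ i : Fin n, fderiv ℝ G x (EuclideanSpace.single i 1) * fderiv ℝ ψ x (EuclideanSpace.single i 1)|
        ≤ ∑ i : Fin n, ‖gradient G x‖ * (C / ε) := by
      refine (Finset.abs_sum_le_sum_abs _ _).trans (Finset.sum_le_sum fun i _ => ?_)
      rw [abs_mul]
      exact mul_le_mul (hi i) (h1 i) (abs_nonneg _) (norm_nonneg _)
    rw [Finset.sum_const, Finset.card_univ, Fintype.card_fin, nsmul_eq_mul] at this
    calc _ ≤ 2 * (n * (‖gradient G x‖ * (C / ε))) := by linarith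
      _ = _ := by ring
  · rw [abs_mul, mul_comm, Real.norm_eq_abs]
    gcongr


/-- a global comparison principle between a harmonic function and a
subharmonic function with matching nontangential traces, in a bounded Ahlfors regular
domain admitting a Green function with the listed properties. -/
theorem statement1 (n : ℕ) (hn : 2 ≤ n)
    (Ω : Set (Euc n)) (hΩo : IsOpen Ω) (hΩne : Ω.Nonempty)
    (hΩbd : Bornology.IsBounded Ω)
    (C₀ : ℝ) (hAR : AhlforsRegularWith n (frontier Ω) C₀)
    (hmt : μH[(n : ℝ) - 1] (frontier Ω \ mtBoundary n Ω) = 0)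
    (σ : Measure (Euc n)) (hσ : σ = (μH[(n : ℝ) - 1]).restrict (frontier Ω))
    (κ : ℝ) (hκ : 0 < κ)
    (p p' : ℝ) (hp : 1 < p) (hpp' : 1 / p + 1 / p' = 1)
    -- u harmonic with N_κ u ∈ L^p(∂Ω,σ)
    (u : Euc n → ℝ) (hu : HarmonicOn' u Ω)
    (hNu : ∫⁻ x, (ntMax Ω κ u x) ^ p ∂σ < ⊤)
    -- w continuous subharmonic with N_κ w ∈ L^p(∂Ω,σ)
    (w : Euc n → ℝ) (hw : SubharmonicOn w Ω)
    (hNw : ∫⁻ x, (ntMax Ω κ w x) ^ p ∂σ < ⊤)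
    -- matching nontangential traces σ-a.e.
    (htr : ∀ᵐ x ∂σ, ∃ f : ℝ, HasNTTrace Ω κ u x f ∧ HasNTTrace Ω κ w x f)
    -- the Green function with pole x₀
    (x₀ : Euc n) (hx₀ : x₀ ∈ Ω) (G : Euc n → ℝ)
    (hG1 : ContDiffOn ℝ (⊤ : ℕ∞) G (Ω \ {x₀}))
    (hG2 : ∀ x ∈ Ω \ {x₀}, 0 < G x)
    (hG3 : LocallyIntegrableOn G Ω volume)
    (hG4 : ∀ φ : Euc n → ℝ, ContDiff ℝ (⊤ : ℕ∞) φ → HasCompactSupport φ → tsupport φ ⊆ Ω →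
      ∫ x in Ω, G x * laplacian φ x = -(φ x₀))
    (hG5 : ∀ᵐ x ∂σ, HasNTTrace Ω κ G x 0)
    (hG6 : ∃ lam κ' ε₀ A : ℝ, 1 < lam ∧ κ ≤ κ' ∧
      0 < ε₀ ∧ ε₀ < infDist x₀ (frontier Ω) / 4 ∧ 0 ≤ A ∧
      ∀ ε : ℝ, 0 < ε → ε < ε₀ →
        ((∫⁻ x, (ntMaxOn Ω (collar Ω (lam * ε)) κ' (fun z => gradient G z) x) ^ p' ∂σ) ^ (1 / p')
            ≤ ENNReal.ofReal A) ∧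
        ∀ᵐ x ∂σ, ntMaxOn Ω (collar Ω ε) κ G x ≤
          ENNReal.ofReal ε * ntMaxOn Ω (collar Ω (lam * ε)) κ' (fun z => gradient G z) x) :
    w x₀ ≤ u x₀ := by
  obtain ⟨lam, κ', ε₀, A, hlam, hκκ', hε₀, hε₀x, hA, hG6⟩ := hG6
  obtain ⟨C, hC, hcut⟩ := cutoff n
  obtain ⟨C₁, r₁, hC₁, hr₁, hlayer⟩ := layer hn hΩo hΩbd hΩne hAR hσ hκ
  have hconj : p.HolderConjugate p' :=
    Real.holderConjugate_iff.2 ⟨hp, by simpa [one_div] using hpp'⟩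
  have hnull : volume ({x₀} : Set (Euc n)) = 0 := by
    have : Nonempty (Fin n) := ⟨⟨0, by omega⟩⟩
    have : Nontrivial (Euc n) := inferInstance
    exact measure_singleton x₀
  have main : ∀ ε : ℝ, 0 < ε → ε < ε₀ → ε < r₁ →
      ENNReal.ofReal (w x₀ - u x₀) ≤ ENNReal.ofReal (C₁ * ((2 * n + 1) * C) * A) *
        (∫⁻ x, (ntMaxOn Ω (collar Ω ε) κ (fun y => w y - u y) x) ^ p ∂σ) ^ (1 / p) := by
    intro ε hε hεε₀ hεr
    obtain ⟨ψ, hψ, hψ0, hψK, hψ1, hψM, hψd, hψl⟩ := hcut Ω hΩo hΩbd ε hε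
    obtain ⟨hgA, hGg⟩ := hG6 ε hε hεε₀
    have hK := inn_compact hΩo hΩbd (a := ε / 4) (by positivity)
    have hM := lay_compact hΩo hΩbd (a := ε / 4) (b := 3 * ε / 4) (by positivity)
    have hMΩ : lay Ω (ε / 4) (3 * ε / 4) ⊆ Ω \ {x₀} := by
      intro y hy
      refine ⟨hy.1, ?_⟩
      rintro rfl
      have := hy.2.2
      linarith
    have h1 := green_key' hΩo hK (fun y hy => hy.1) hM hMΩ (fun y hy => ⟨hy.1, hy.2.1⟩) hG1 hG2 hG3 hG4
      hψ hψ0 hψK (hψ1 x₀ hx₀ (by linarith)) hψM hu hw hnull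
    have hcont : ContinuousOn (fun x => |w x - u x| * |errD G ψ x|) (lay Ω (ε / 4) (3 * ε / 4)) := by
      have hvc : ContinuousOn (fun x => w x - u x) (lay Ω (ε / 4) (3 * ε / 4)) :=
        (hw.1.sub hu.1.continuousOn).mono fun y hy => hy.1
      have he := errD_continuous (hΩo.sdiff isClosed_singleton) hM.isClosed hMΩ hG1 hψ hψM
      exact hvc.abs.mul he.abs.continuousOn
    have hMm := hM.isClosed.measurableSet
    have h2 : ENNReal.ofReal (w x₀ - u x₀) ≤
        ∫⁻ x in lay Ω (ε / 4) (3 * ε / 4), ENNReal.ofReal (|w x - u x| * |errD G ψ x|) := by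
      refine (ENNReal.ofReal_le_ofReal h1).trans ?_
      rw [integral_eq_lintegral_of_nonneg_ae (Eventually.of_forall fun x => by positivity)
        (hcont.aestronglyMeasurable hMm)]
      exact ENNReal.ofReal_toReal_le
    refine h2.trans ?_
    set Nv := ntMaxOn Ω (collar Ω ε) κ (fun y => w y - u y) with hNv
    set Ng := ntMaxOn Ω (collar Ω (lam * ε)) κ' (fun z => gradient G z) with hNg
    have hsub : ∀ x, ntRegion Ω κ x ∩ collar Ω ε ⊆ ntRegion Ω κ' x ∩ collar Ω (lam * ε) := by
      rintro x y ⟨⟨hy1, hy2⟩, -, hy3⟩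
      refine ⟨⟨hy1, hy2.trans_le ?_⟩, hy1, hy3.trans ?_⟩
      · have := infDist_nonneg (x := y) (s := frontier Ω)
        gcongr
      · nlinarith
    have h3 := hlayer ε hε hεr (fun x => ENNReal.ofReal (|w x - u x| * |errD G ψ x|))
      (fun x => ENNReal.ofReal ((2 * n + 1) * C / ε) * (Nv x * Ng x))
      (hcont.aemeasurable hMm).ennreal_ofReal ?_
    · refine h3.trans ?_
      rw [lintegral_const_mul' _ _ ENNReal.ofReal_ne_top, ← mul_assoc, ← ENNReal.ofReal_mul (by positivity)]
      have h4 := ENNReal.lintegral_mul_le_Lp_mul_Lq σ hconj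
        (measurable_ntMaxOn hΩo (isOpen_collar hΩo ε) κ (fun y => w y - u y)).aemeasurable
        (measurable_ntMaxOn hΩo (isOpen_collar hΩo (lam * ε)) κ' (fun z => gradient G z)).aemeasurable
      have h5 : C₁ * ε * ((2 * n + 1) * C / ε) = C₁ * ((2 * n + 1) * C) := by field_simp
      rw [h5]
      calc _ ≤ ENNReal.ofReal (C₁ * ((2 * n + 1) * C)) *
            ((∫⁻ x, Nv x ^ p ∂σ) ^ (1 / p) * ENNReal.ofReal A) := by
            gcongr
            exact h4.trans (by gcongr)
        _ = _ := by
            rw [ENNReal.ofReal_mul (p := C₁ * ((2 * n + 1) * C)) (by positivity)]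
            ring
    · filter_upwards [hGg] with x hx
      filter_upwards [ENNReal.ae_le_essSup (μ := volume.restrict (ntRegion Ω κ x ∩ collar Ω ε))
          (fun y => (‖w y - u y‖₊ : ℝ≥0∞)),
        ENNReal.ae_le_essSup (μ := volume.restrict (ntRegion Ω κ x ∩ collar Ω ε)) (fun y => (‖G y‖₊ : ℝ≥0∞)),
        ae_restrict_of_ae_restrict_of_subset (hsub x)
          (ENNReal.ae_le_essSup (μ := volume.restrict (ntRegion Ω κ' x ∩ collar Ω (lam * ε)))
            (fun y => (‖gradient G y‖₊ : ℝ≥0∞)))] with y hy1 hy2 hy3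
      have hy1' : (‖w y - u y‖₊ : ℝ≥0∞) ≤ Nv x := hy1
      have hy2' : (‖G y‖₊ : ℝ≥0∞) ≤ ENNReal.ofReal ε * Ng x := le_trans hy2 hx
      have hy3' : (‖gradient G y‖₊ : ℝ≥0∞) ≤ Ng x := hy3
      have hb := errD_bound (G := G) hC hε (hψd y) (hψl y)
      have hnn : ∀ {E : Type} [NormedAddCommGroup E] (z : E), ENNReal.ofReal ‖z‖ = (‖z‖₊ : ℝ≥0∞) := by
        intro E _ z
        rw [← coe_nnnorm, ENNReal.ofReal_coe_nnreal]
      have he : ENNReal.ofReal |errD G ψ y| ≤ ENNReal.ofReal ((2 * n + 1) * C / ε) * Ng x := by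
        refine (ENNReal.ofReal_le_ofReal hb).trans ?_
        rw [ENNReal.ofReal_add (by positivity) (by positivity), ENNReal.ofReal_mul (by positivity),
          ENNReal.ofReal_mul (by positivity), hnn, hnn]
        calc _ ≤ ENNReal.ofReal (2 * n * C / ε) * Ng x + ENNReal.ofReal (C / ε ^ 2) * (ENNReal.ofReal ε * Ng x) := by
              gcongr
          _ = _ := by
              rw [← mul_assoc, ← ENNReal.ofReal_mul (by positivity), ← add_mul,
                ← ENNReal.ofReal_add (by positivity) (by positivity)]
              congr 2
              field_simp
      rw [ENNReal.ofReal_mul (abs_nonneg _), ← Real.norm_eq_abs (w y - u y), hnn]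
      calc _ ≤ Nv x * (ENNReal.ofReal ((2 * n + 1) * C / ε) * Ng x) := mul_le_mul' hy1' he
        _ = _ := by ring
  have hlim := lp_tendsto hΩo hκ hp hNu hNw htr
  have hlim2 := ENNReal.Tendsto.const_mul (a := ENNReal.ofReal (C₁ * ((2 * n + 1) * C) * A)) hlim
    (Or.inr ENNReal.ofReal_ne_top)
  rw [mul_zero] at hlim2
  have hfin : ENNReal.ofReal (w x₀ - u x₀) ≤ 0 := by
    refine ge_of_tendsto hlim2 ?_
    have e1 : ∀ᶠ ε : ℝ in 𝓝[>] 0, ε < ε₀ := (eventually_lt_nhds hε₀).filter_mono nhdsWithin_le_nhds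
    have e2 : ∀ᶠ ε : ℝ in 𝓝[>] 0, ε < r₁ := (eventually_lt_nhds hr₁).filter_mono nhdsWithin_le_nhds
    filter_upwards [e1, e2, self_mem_nhdsWithin] with ε h1 h2 h3
    exact main ε h3 h1 h2
  have := ENNReal.ofReal_eq_zero.1 (le_antisymm hfin zero_le)
  linarith
end

section
/- Let n ≥ 2, let Ω ⊆ ℝⁿ be open, and let F = (F₁,…,F_n) : Ω → ℝⁿ be a C² vector field satisfying the generalized Cauchy–Riemann system: ∂_j F_k = ∂_k F_j on Ω for all j, k ∈ {1,…,n}, and ∑_{j=1}^n ∂_j F_j = 0 on Ω. Then for every exponent θ with (n−2)/(n−1) ≤ θ ≤ 1, the function |F|^θ (Euclidean norm of F raised to the power θ) is subharmonic in Ω: it is continuous, and for every x ∈ Ω and r > 0 with the closed ball of center x and radius r contained in Ω one has |F(x)|^θ ≤ (1/ℒⁿ(B(x,r))) ∫_{B(x,r)} |F(y)|^θ dℒⁿ(y). -/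
open MeasureTheory Metric Set Filter
open scoped ENNReal NNReal Topology

lemma aux_traceless (n : ℕ) (T : Euc n →ₗ[ℝ] Euc n) (hT : T.IsSymmetric)
    (htr : ∑ i, inner ℝ (EuclideanSpace.single i (1 : ℝ)) (T (EuclideanSpace.single i 1)) = 0)
    (ξ : Euc n) :
    (n : ℝ) * ‖T ξ‖ ^ 2 ≤
      ((n : ℝ) - 1) * (∑ i : Fin n, ‖T (EuclideanSpace.single i 1)‖ ^ 2) * ‖ξ‖ ^ 2 := by
  have hfr : Module.finrank ℝ (Euc n) = n := by simp
  let b := hT.eigenvectorBasis hfr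
  let l := hT.eigenvalues hfr
  have hb : ∀ i, T (b i) = l i • b i := fun i => by
    exact hT.apply_eigenvectorBasis hfr i
  let c := EuclideanSpace.basisFun (Fin n) ℝ
  have hc : ∀ i, c i = EuclideanSpace.single i (1 : ℝ) := fun i => by simp [c]
  have hbn : ∀ i, inner ℝ (b i) (b i) = (1 : ℝ) := fun i => by
    rw [real_inner_self_eq_norm_sq, b.orthonormal.1 i]; norm_num
  have h1 : ∑ i, l i = 0 := by
    have e1 := LinearMap.trace_eq_sum_inner T b
    have e2 := LinearMap.trace_eq_sum_inner T c
    simp only [hc] at e2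
    rw [htr] at e2
    rw [e2] at e1
    simp only [hb, inner_smul_right, hbn, mul_one] at e1
    exact e1.symm
  have h2 : ∑ i : Fin n, ‖T (EuclideanSpace.single i 1)‖ ^ 2 = ∑ i, l i ^ 2 := by
    have e1 := LinearMap.trace_eq_sum_inner (T ∘ₗ T) b
    have e2 := LinearMap.trace_eq_sum_inner (T ∘ₗ T) c
    rw [e2] at e1
    simp only [LinearMap.comp_apply, ← hT _ (T _), hc, real_inner_self_eq_norm_sq] at e1
    rw [e1]
    refine Finset.sum_congr rfl fun i _ => ?_
    rw [hb, norm_smul, b.orthonormal.1 i]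
    simp
  have h3 : ∀ j, (n : ℝ) * l j ^ 2 ≤ ((n : ℝ) - 1) * ∑ i, l i ^ 2 := by
    intro j
    have a1 : ∑ i ∈ Finset.univ.erase j, l i = - l j := by
      have := Finset.add_sum_erase Finset.univ l (Finset.mem_univ j)
      linarith
    have a2 := Finset.add_sum_erase Finset.univ (fun i => l i ^ 2) (Finset.mem_univ j)
    have a3 := sq_sum_le_card_mul_sum_sq (s := Finset.univ.erase j) (f := l)
    rw [a1, Finset.card_erase_of_mem (Finset.mem_univ j), Finset.card_univ, Fintype.card_fin] at a3
    have : 1 ≤ n := by have := j.2; omega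
    push_cast [Nat.cast_sub this] at a3
    rw [← a2]
    nlinarith
  have h4 : ‖T ξ‖ ^ 2 = ∑ i, l i ^ 2 * inner ℝ (b i) ξ ^ 2 := by
    rw [← b.sum_sq_norm_inner_right]
    refine Finset.sum_congr rfl fun i _ => ?_
    rw [← hT, hb, inner_smul_left, Real.norm_eq_abs, sq_abs]
    simp [mul_pow]
  have h5 : ‖ξ‖ ^ 2 = ∑ i, inner ℝ (b i) ξ ^ 2 := by
    rw [← b.sum_sq_norm_inner_right]
    simp
  rw [h2, h4, h5, Finset.mul_sum, Finset.mul_sum]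
  refine Finset.sum_le_sum fun i _ => ?_
  rw [← mul_assoc]
  exact mul_le_mul_of_nonneg_right (h3 i) (sq_nonneg _)

/-- The weight `(1 - |y|²)₊ / 2`. -/
noncomputable def auxRho (n : ℕ) (y : Euc n) : ℝ := (1 - (min ‖y‖ 1) ^ 2) / 2

lemma auxRho_nonneg (n : ℕ) (y : Euc n) : 0 ≤ auxRho n y := by
  unfold auxRho
  have h1 : min ‖y‖ 1 ≤ 1 := min_le_right _ _
  have h0 : 0 ≤ min ‖y‖ 1 := le_min (norm_nonneg _) zero_le_one
  nlinarith

lemma auxRho_eq_zero (n : ℕ) (y : Euc n) (hy : 1 ≤ ‖y‖) : auxRho n y = 0 := by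
  simp [auxRho, min_eq_right hy]

lemma auxRho_lip (n : ℕ) : LipschitzWith 1 (auxRho n) := by
  refine LipschitzWith.of_le_add_mul 1 fun x y => ?_
  unfold auxRho
  have h0 : 0 ≤ min ‖x‖ 1 := le_min (norm_nonneg _) zero_le_one
  have h1 : min ‖x‖ 1 ≤ 1 := min_le_right _ _
  have h2 : min ‖y‖ 1 ≤ 1 := min_le_right _ _
  have h0' : 0 ≤ min ‖y‖ 1 := le_min (norm_nonneg _) zero_le_one
  have h3 : min ‖y‖ 1 ≤ min ‖x‖ 1 + dist x y := by
    have : ‖y‖ ≤ ‖x‖ + dist x y := by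
      rw [dist_comm, dist_eq_norm]
      simpa using norm_add_le x (y - x)
    rcases le_total ‖x‖ 1 with h | h
    · rw [min_eq_left h]; exact (min_le_left _ _).trans this
    · rw [min_eq_right h]; linarith [dist_nonneg (x := x) (y := y)]
  have hd := dist_nonneg (x := x) (y := y)
  simp only [NNReal.coe_one, one_mul]
  nlinarith

lemma auxRho_supp (n : ℕ) : HasCompactSupport (auxRho n) :=
  HasCompactSupport.intro (isCompact_closedBall (0 : Euc n) 1) fun y hy => by
    apply auxRho_eq_zero
    simp at hy
    exact hy.le

lemma auxRho_lineDeriv (n : ℕ) (y : Euc n) (hy : ‖y‖ ≠ 1) (i : Fin n) :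
    lineDeriv ℝ (auxRho n) y (-(EuclideanSpace.single i (1 : ℝ))) =
      (ball (0 : Euc n) 1).indicator (fun y => y i) y := by
  rcases lt_or_gt_of_ne hy with h | h
  · rw [indicator_of_mem (by simpa using h)]
    have h1 : auxRho n =ᶠ[𝓝 y] fun y => (1 - ‖y‖ ^ 2) / 2 := by
      filter_upwards [(isOpen_lt continuous_norm continuous_const).mem_nhds h] with z hz
      have : ‖z‖ < 1 := hz
      simp [auxRho, min_eq_left this.le]
    have h2 : HasFDerivAt (fun y : Euc n => (1 - ‖y‖ ^ 2) / 2) ((1 / 2 : ℝ) • (- ((2 : ℝ) • innerSL ℝ y) : Euc n →L[ℝ] ℝ)) y := by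
      have := ((hasStrictFDerivAt_norm_sq y).hasFDerivAt.const_sub 1).const_smul (1 / 2 : ℝ)
      have hfun : (fun y : Euc n => (1 - ‖y‖ ^ 2) / 2) =
          (1 / 2 : ℝ) • fun y : Euc n => 1 - ‖y‖ ^ 2 := by
        funext z
        simp only [Pi.smul_apply, smul_eq_mul]
        ring
      rw [hfun]
      refine this.congr_fderiv ?_
      ext z
      simp
    rw [((h2.congr_of_eventuallyEq h1).hasLineDerivAt _).lineDeriv]
    simp [EuclideanSpace.inner_single_right]
  · rw [indicator_of_notMem (by simpa using h.le)]
    have h1 : auxRho n =ᶠ[𝓝 y] fun y => 0 := by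
      filter_upwards [(isOpen_lt continuous_const continuous_norm).mem_nhds h] with z hz
      exact auxRho_eq_zero n z (le_of_lt hz)
    rw [(((hasFDerivAt_const (0 : ℝ) y).congr_of_eventuallyEq h1).hasLineDerivAt _).lineDeriv]
    simp

lemma aux_ibp (n : ℕ) (hn : 1 ≤ n) (G : Euc n → ℝ) (hG : ContDiff ℝ 1 G) (hc : HasCompactSupport G)
    (x : Euc n) (t : ℝ) (i : Fin n) :
    ∫ y in ball (0 : Euc n) 1, y i * G (x + t • y) =
      t * ∫ y, fderiv ℝ G (x + t • y) (EuclideanSpace.single i 1) * auxRho n y := by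
  obtain ⟨C, hC⟩ := ContDiff.lipschitzWith_of_hasCompactSupport hc hG (by simp)
  have : Nonempty (Fin n) := ⟨⟨0, hn⟩⟩
  have hA : ∀ y : Euc n, HasFDerivAt (fun y : Euc n => x + t • y)
      (t • ContinuousLinearMap.id ℝ (Euc n)) y := fun y =>
    ((hasFDerivAt_id y).const_smul t).const_add x
  have hL : LipschitzWith (C * ‖t‖₊) (fun y : Euc n => G (x + t • y)) := by
    refine hC.comp (LipschitzWith.of_dist_le_mul fun a b => ?_)
    rw [dist_add_left, dist_smul₀]
    simp
  have key := LipschitzWith.integral_lineDeriv_mul_eq (μ := volume) hL (auxRho_lip n)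
    (auxRho_supp n) (EuclideanSpace.single i (1 : ℝ))
  have e1 : ∀ y : Euc n, lineDeriv ℝ (fun y : Euc n => G (x + t • y)) y
      (EuclideanSpace.single i (1 : ℝ)) =
      t * fderiv ℝ G (x + t • y) (EuclideanSpace.single i 1) := by
    intro y
    have h1 : HasFDerivAt G (fderiv ℝ G (x + t • y)) (x + t • y) :=
      ((hG.differentiable (by simp)) _).hasFDerivAt
    have h2 := (h1.comp y (hA y)).hasLineDerivAt (EuclideanSpace.single i (1 : ℝ))
    have h3 := h2.lineDeriv
    rw [show (fun y : Euc n => G (x + t • y)) = G ∘ (fun y : Euc n => x + t • y) from rfl, h3]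
    simp
  simp only [e1, mul_assoc] at key
  rw [integral_const_mul] at key
  rw [key, ← integral_indicator measurableSet_ball]
  refine integral_congr_ae ?_
  have hs : volume (sphere (0 : Euc n) 1) = 0 := Measure.addHaar_sphere _ _ _
  filter_upwards [compl_mem_ae_iff.2 hs] with y hy
  rw [auxRho_lineDeriv n y (by simpa using hy)]
  by_cases h : y ∈ ball (0 : Euc n) 1
  · simp only [indicator_of_mem h]
  · simp only [indicator_of_notMem h, zero_mul]

lemma aux_submean_global (n : ℕ) (hn : 1 ≤ n) (v : Euc n → ℝ) (hv : ContDiff ℝ 2 v)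
    (hc : HasCompactSupport v) (x : Euc n) (r : ℝ) (hr : 0 < r)
    (hlap : ∀ y ∈ ball x r, 0 ≤ laplacian v y) :
    v x ≤ ⨍ y in ball x r, v y := by
  let G : Fin n → Euc n → ℝ := fun i z => fderiv ℝ v z (EuclideanSpace.single i 1)
  have hfd : ContDiff ℝ 1 (fderiv ℝ v) := hv.fderiv_right (by norm_num)
  have hG : ∀ i, ContDiff ℝ 1 (G i) := fun i => hfd.clm_apply contDiff_const
  have hGc : ∀ i, HasCompactSupport (G i) := fun i => hc.fderiv_apply ℝ _
  have hdec : ∀ z y : Euc n, fderiv ℝ v z y = ∑ i, y i * G i z := by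
    intro z y
    have : y = ∑ i, y i • EuclideanSpace.single i (1 : ℝ) := by
      have := (EuclideanSpace.basisFun (Fin n) ℝ).sum_repr y
      simpa using this.symm
    conv_lhs => rw [this]
    simp [G]
  obtain ⟨C, hC⟩ := (hc.fderiv ℝ).exists_bound_of_continuous hfd.continuous
  have hcontA : ∀ t : ℝ, Continuous (fun y : Euc n => x + t • y) := fun t => by fun_prop
  have hfin : IsFiniteMeasure (volume.restrict (ball (0 : Euc n) 1)) :=
    ⟨by simpa using measure_ball_lt_top⟩
  have hintc : ∀ f : Euc n → ℝ, Continuous f → IntegrableOn f (ball (0 : Euc n) 1) := fun f hf =>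
    (hf.continuousOn.integrableOn_compact (isCompact_closedBall (0 : Euc n) 1)).mono_set
      ball_subset_closedBall
  let φ : ℝ → ℝ := fun t => ∫ y in ball (0 : Euc n) 1, v (x + t • y)
  have hφ : ∀ t, HasDerivAt φ (∫ y in ball (0 : Euc n) 1, fderiv ℝ v (x + t • y) y) t := by
    intro t
    refine (hasDerivAt_integral_of_dominated_loc_of_deriv_le
      (F := fun t y => v (x + t • y)) (F' := fun t y => fderiv ℝ v (x + t • y) y)
      (bound := fun _ => C) (s := univ) univ_mem ?_ ?_ ?_ ?_ ?_ ?_).2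
    · exact Eventually.of_forall fun s => (hv.continuous.comp (hcontA s)).aestronglyMeasurable
    · exact hintc _ (hv.continuous.comp (hcontA t))
    · exact ((hfd.continuous.comp (hcontA t)).clm_apply continuous_id).aestronglyMeasurable
    · refine (ae_restrict_mem measurableSet_ball).mono fun y hy s _ => ?_
      have hy1 : ‖y‖ ≤ 1 := by simpa using (mem_ball.1 hy).le
      calc ‖fderiv ℝ v (x + s • y) y‖ ≤ ‖fderiv ℝ v (x + s • y)‖ * ‖y‖ :=
            ContinuousLinearMap.le_opNorm _ _
        _ ≤ ‖fderiv ℝ v (x + s • y)‖ * 1 := by gcongr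
        _ ≤ C := by rw [mul_one]; exact hC _
    · exact integrable_const _
    · refine Eventually.of_forall fun y s _ => ?_
      have h1 : HasFDerivAt v (fderiv ℝ v (x + s • y)) (x + s • y) :=
        ((hv.differentiable (by simp)) _).hasFDerivAt
      have h2 : HasDerivAt (fun s : ℝ => x + s • y) y s := by
        simpa using ((hasDerivAt_id s).smul_const y).const_add x
      exact h1.comp_hasDerivAt s h2
  have hnonneg : ∀ t ∈ Icc (0 : ℝ) r, 0 ≤ ∫ y in ball (0 : Euc n) 1, fderiv ℝ v (x + t • y) y := by
    intro t ht
    simp only [hdec]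
    have hcoord : ∀ i : Fin n, Continuous (fun y : Euc n => y i) := fun i => by fun_prop
    have hint : ∀ i ∈ Finset.univ, IntegrableOn (fun y : Euc n => y i * G i (x + t • y))
        (ball (0 : Euc n) 1) := fun i _ =>
      hintc _ ((hcoord i).mul ((hG i).continuous.comp (hcontA t)))
    rw [integral_finsetSum _ hint]
    simp only [aux_ibp n hn _ (hG _) (hGc _)]
    rw [← Finset.mul_sum, ← integral_finsetSum]
    · refine mul_nonneg ht.1 (integral_nonneg fun y => ?_)
      simp only [Pi.zero_apply, ← Finset.sum_mul]
      by_cases hy : 1 ≤ ‖y‖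
      · rw [auxRho_eq_zero n y hy, mul_zero]
      · refine mul_nonneg (hlap (x + t • y) ?_) (auxRho_nonneg n y)
        rw [mem_ball, dist_eq_norm, add_sub_cancel_left, norm_smul, Real.norm_eq_abs,
          abs_of_nonneg ht.1]
        push Not at hy
        calc t * ‖y‖ ≤ r * ‖y‖ := by gcongr; exact ht.2
          _ < r := by nlinarith
    · intro i _
      refine Continuous.integrable_of_hasCompactSupport ?_ (HasCompactSupport.mul_left (auxRho_supp n))
      refine Continuous.mul ?_ (auxRho_lip n).continuous
      exact ((((hG i).continuous_fderiv (by simp)).comp (hcontA t)).clm_apply continuous_const)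
  have hmono : MonotoneOn φ (Icc 0 r) := by
    refine monotoneOn_of_deriv_nonneg (convex_Icc 0 r)
      (fun t _ => (hφ t).continuousAt.continuousWithinAt)
      (fun t _ => (hφ t).differentiableAt.differentiableWithinAt) fun t ht => ?_
    rw [(hφ t).deriv]
    exact hnonneg t (interior_subset ht)
  have hle := hmono (left_mem_Icc.2 hr.le) (right_mem_Icc.2 hr.le) hr.le
  have h0 : φ 0 = volume.real (ball (0 : Euc n) 1) * v x := by
    simp [φ]
  have h1 : φ r = (r ^ n)⁻¹ * ∫ y in ball x r, v y := by
    have e := Measure.setIntegral_comp_smul_of_pos volume (fun y => v (x + y))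
      (ball (0 : Euc n) 1) hr
    simp only [φ]
    rw [e, smul_unitBall_of_pos hr]
    have e2 := (measurePreserving_add_left volume x).setIntegral_preimage_emb
      (MeasurableEquiv.addLeft x).measurableEmbedding v (ball x r)
    rw [← e2]
    simp [preimage_add_ball]
  have hne : Nonempty (Fin n) := ⟨⟨0, hn⟩⟩
  have h2 : volume.real (ball x r) = r ^ n * volume.real (ball (0 : Euc n) 1) := by
    rw [Measure.real, Measure.addHaar_ball _ _ hr.le]
    simp [Measure.real, hr.le]
  have hpos : 0 < volume.real (ball (0 : Euc n) 1) :=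
    ENNReal.toReal_pos (measure_ball_pos _ _ one_pos).ne' measure_ball_lt_top.ne
  rw [setAverage_eq, h2, smul_eq_mul]
  rw [h0, h1] at hle
  rw [mul_inv, mul_right_comm, ← div_eq_mul_inv, le_div_iff₀ hpos]
  linarith

lemma aux_lap_congr (n : ℕ) (u v : Euc n → ℝ) (x : Euc n) (h : u =ᶠ[𝓝 x] v) :
    laplacian u x = laplacian v x := by
  unfold laplacian
  refine Finset.sum_congr rfl fun i _ => ?_
  have h1 : (fun z => fderiv ℝ u z (EuclideanSpace.single i 1)) =ᶠ[𝓝 x]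
      (fun z => fderiv ℝ v z (EuclideanSpace.single i 1)) := by
    filter_upwards [h.fderiv (𝕜 := ℝ)] with z hz
    rw [hz]
  rw [h1.fderiv_eq]

lemma aux_submean (n : ℕ) (hn : 1 ≤ n) (Ω : Set (Euc n)) (hΩ : IsOpen Ω) (u : Euc n → ℝ)
    (hu : ContDiffOn ℝ 2 u Ω) (hlap : ∀ x ∈ Ω, 0 ≤ laplacian u x)
    (x : Euc n) (r : ℝ) (hr : 0 < r) (hsub : closedBall x r ⊆ Ω) :
    u x ≤ ⨍ y in ball x r, u y := by
  obtain ⟨δ, hδ, hδΩ⟩ := (isCompact_closedBall x r).exists_cthickening_subset_open hΩ hsub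
  rw [cthickening_closedBall hδ.le hr.le] at hδΩ
  let f : ContDiffBump x := ⟨r, r + δ, hr, by linarith⟩
  have hts : tsupport f ⊆ Ω := by
    rw [f.tsupport_eq]
    refine subset_trans (le_of_eq ?_) hδΩ
    simp [f, add_comm]
  let v : Euc n → ℝ := fun y => f y * u y
  have hv : ContDiff ℝ 2 v := by
    rw [contDiff_iff_contDiffAt]
    intro y
    by_cases hy : y ∈ Ω
    · exact f.contDiff.contDiffAt.mul (hu.contDiffAt (hΩ.mem_nhds hy))
    · have h0 : v =ᶠ[𝓝 y] fun _ => 0 := by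
        have hy' : y ∉ tsupport f := fun h => hy (hts h)
        filter_upwards [(isClosed_tsupport f).isOpen_compl.mem_nhds hy'] with z hz
        simp [v, image_eq_zero_of_notMem_tsupport hz]
      exact contDiffAt_const.congr_of_eventuallyEq h0
  have hc : HasCompactSupport v := f.hasCompactSupport.mul_right
  have heq : ∀ y ∈ ball x r, v y = u y := fun y hy => by
    simp only [v]
    rw [f.one_of_mem_closedBall (ball_subset_closedBall hy), one_mul]
  have key := aux_submean_global n hn v hv hc x r hr (fun y hy => by
    rw [aux_lap_congr n v u y (by
      filter_upwards [isOpen_ball.mem_nhds hy] with z hz using heq z hz)]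
    exact hlap y (hsub (ball_subset_closedBall hy)))
  rw [heq x (mem_ball_self hr)] at key
  rwa [setAverage_congr_fun measurableSet_ball (Eventually.of_forall heq)] at key

lemma aux_lap_zero (n : ℕ) (Ω : Set (Euc n)) (hΩ : IsOpen Ω)
    (F : Euc n → Euc n) (hF : ContDiffOn ℝ 2 F Ω)
    (hsym : ∀ x ∈ Ω, ∀ j k : Fin n,
      fderiv ℝ (fun z => F z k) x (EuclideanSpace.single j 1) =
        fderiv ℝ (fun z => F z j) x (EuclideanSpace.single k 1))
    (hdiv : ∀ x ∈ Ω,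
      ∑ j : Fin n, fderiv ℝ (fun z => F z j) x (EuclideanSpace.single j 1) = 0)
    (x : Euc n) (hx : x ∈ Ω) (k : Fin n) :
    ∑ i : Fin n, fderiv ℝ (fun z => fderiv ℝ (fun w => F w k) z (EuclideanSpace.single i 1)) x
      (EuclideanSpace.single i 1) = 0 := by
  have hFk : ∀ k, ContDiffOn ℝ 2 (fun z => F z k) Ω := fun k =>
    contDiffOn_euclidean.1 hF k
  have hC : ∀ k, ContDiffAt ℝ 2 (fun z => F z k) x := fun k =>
    (hFk k).contDiffAt (hΩ.mem_nhds hx)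
  have hd : ∀ k, DifferentiableAt ℝ (fderiv ℝ (fun z => F z k)) x := fun k =>
    ((hC k).fderiv_right (m := 1) (by norm_num)).differentiableAt (by simp)
  have hap : ∀ k i j, fderiv ℝ (fun z => fderiv ℝ (fun w => F w k) z (EuclideanSpace.single i 1)) x
      (EuclideanSpace.single j 1) = fderiv ℝ (fderiv ℝ (fun w => F w k)) x
        (EuclideanSpace.single j 1) (EuclideanSpace.single i 1) := by
    intro k i j
    rw [fderiv_clm_apply (hd k) (differentiableAt_const _)]
    simp
  have h1 : ∀ i, fderiv ℝ (fun z => fderiv ℝ (fun w => F w k) z (EuclideanSpace.single i 1)) x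
      (EuclideanSpace.single i 1) =
      fderiv ℝ (fun z => fderiv ℝ (fun w => F w i) z (EuclideanSpace.single i 1)) x
      (EuclideanSpace.single k 1) := by
    intro i
    have h2 : (fun z => fderiv ℝ (fun w => F w k) z (EuclideanSpace.single i 1)) =ᶠ[𝓝 x]
        (fun z => fderiv ℝ (fun w => F w i) z (EuclideanSpace.single k 1)) := by
      filter_upwards [hΩ.mem_nhds hx] with z hz using hsym z hz i k
    rw [h2.fderiv_eq, hap, hap]
    exact ((hC i).isSymmSndFDerivAt (by simp)) _ _
  simp only [h1]
  have h3 : (fun z => ∑ i : Fin n, fderiv ℝ (fun w => F w i) z (EuclideanSpace.single i 1))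
      =ᶠ[𝓝 x] fun _ => (0 : ℝ) := by
    filter_upwards [hΩ.mem_nhds hx] with z hz using hdiv z hz
  have h4 := h3.fderiv_eq (𝕜 := ℝ)
  rw [fderiv_fun_sum (fun i _ => (hd i).clm_apply (differentiableAt_const _))] at h4
  have h5 := congrArg (fun L => L (EuclideanSpace.single k (1 : ℝ))) h4
  simpa using h5

lemma aux_final (n : ℝ) (hn2 : 2 ≤ n) (θ : ℝ) (hθ0 : 0 ≤ θ) (hθ1 : (n - 2) / (n - 1) ≤ θ)
    (S Q N ε w : ℝ) (hε : 0 < ε) (hS : 0 ≤ S) (hQ : 0 ≤ Q) (hw : 0 ≤ w)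
    (hmain : n * Q ≤ (n - 1) * S * N) :
    0 ≤ 2 * (θ / 2) * ((θ / 2 - 1) * w * 2 * Q + w * (N + ε) * S) := by
  have hn1 : (0 : ℝ) < n - 1 := by linarith
  have hth : n - 2 ≤ θ * (n - 1) := (div_le_iff₀ hn1).1 hθ1
  have hfin : (2 - θ) * Q ≤ S * (N + ε) := by
    have a1 : (n - 1) * ((2 - θ) * Q) ≤ n * Q := by nlinarith
    have a2 : (n - 1) * S * N ≤ (n - 1) * (S * (N + ε)) := by
      have : 0 ≤ (n - 1) * (S * ε) := by positivity
      linarith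
    exact le_of_mul_le_mul_left (a1.trans (hmain.trans a2)) hn1
  have hk : 2 * (θ / 2) * ((θ / 2 - 1) * w * 2 * Q + w * (N + ε) * S) =
      θ * w * (S * (N + ε) - (2 - θ) * Q) := by ring
  rw [hk]
  exact mul_nonneg (mul_nonneg hθ0 hw) (by linarith)

set_option maxHeartbeats 1000000 in
lemma aux_lap_nonneg (n : ℕ) (hn : 2 ≤ n) (Ω : Set (Euc n)) (hΩ : IsOpen Ω)
    (F : Euc n → Euc n) (hF : ContDiffOn ℝ 2 F Ω)
    (hsym : ∀ x ∈ Ω, ∀ j k : Fin n,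
      fderiv ℝ (fun z => F z k) x (EuclideanSpace.single j 1) =
        fderiv ℝ (fun z => F z j) x (EuclideanSpace.single k 1))
    (hdiv : ∀ x ∈ Ω,
      ∑ j : Fin n, fderiv ℝ (fun z => F z j) x (EuclideanSpace.single j 1) = 0)
    (θ : ℝ) (hθ0 : 0 ≤ θ) (hθ1 : ((n : ℝ) - 2) / ((n : ℝ) - 1) ≤ θ) (ε : ℝ) (hε : 0 < ε)
    (x : Euc n) (hx : x ∈ Ω) :
    0 ≤ laplacian (fun z => (‖F z‖ ^ 2 + ε) ^ (θ / 2)) x := by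
  let e : Fin n → Euc n := fun i => EuclideanSpace.single i (1 : ℝ)
  have hCz : ∀ z ∈ Ω, ContDiffAt ℝ 2 F z := fun z hz => hF.contDiffAt (hΩ.mem_nhds hz)
  have hDz : ∀ z ∈ Ω, HasFDerivAt F (fderiv ℝ F z) z := fun z hz =>
    ((hCz z hz).differentiableAt (by simp)).hasFDerivAt
  have hco : ∀ z ∈ Ω, ∀ (k : Fin n) (w : Euc n),
      (fderiv ℝ F z w) k = fderiv ℝ (fun y => F y k) z w := by
    intro z hz k w
    have := ((EuclideanSpace.proj k : Euc n →L[ℝ] ℝ).hasFDerivAt.comp z (hDz z hz)).fderiv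
    have h2 : fderiv ℝ (fun y => F y k) z = _ := this
    rw [h2]
    simp
  have hd2 : DifferentiableAt ℝ (fderiv ℝ F) x :=
    ((hCz x hx).fderiv_right (m := 1) (by norm_num)).differentiableAt (by simp)
  let T : Euc n →L[ℝ] Euc n := fderiv ℝ F x
  have hTe : ∀ i j, (T (e i)) j = (T (e j)) i := by
    intro i j
    rw [hco x hx, hco x hx]
    exact hsym x hx i j
  have hdecomp : ∀ a : Euc n, a = ∑ i, a i • e i := fun a => by
    have := (EuclideanSpace.basisFun (Fin n) ℝ).sum_repr a
    simpa using this.symm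
  have hinner : ∀ a b : Euc n, inner ℝ (T a) b = ∑ i, ∑ j, a i * b j * (T (e i)) j := by
    intro a b
    conv_lhs => rw [hdecomp a]
    simp only [map_sum, map_smul, sum_inner, inner_smul_left]
    refine Finset.sum_congr rfl fun i _ => ?_
    rw [PiLp.inner_apply, Finset.mul_sum]
    refine Finset.sum_congr rfl fun j _ => ?_
    simp
    ring
  have hTs : (T : Euc n →ₗ[ℝ] Euc n).IsSymmetric := by
    intro a b
    change inner ℝ (T a) b = inner ℝ a (T b)
    rw [real_inner_comm (T b) a, hinner, hinner, Finset.sum_comm]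
    refine Finset.sum_congr rfl fun i _ => Finset.sum_congr rfl fun j _ => ?_
    rw [hTe]; ring
  have htr : ∑ i, inner ℝ (EuclideanSpace.single i (1 : ℝ))
      ((T : Euc n →ₗ[ℝ] Euc n) (EuclideanSpace.single i 1)) = 0 := by
    rw [← hdiv x hx]
    refine Finset.sum_congr rfl fun i _ => ?_
    rw [← hco x hx]
    simp [EuclideanSpace.inner_single_left, T]
  have hmain := aux_traceless n T hTs htr (F x)
  -- second derivatives
  let DD : Fin n → Euc n := fun i => fderiv ℝ (fun z => fderiv ℝ F z (e i)) x (e i)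
  have hDd : ∀ i, HasFDerivAt (fun z => fderiv ℝ F z (e i))
      (fderiv ℝ (fun z => fderiv ℝ F z (e i)) x) x := fun i =>
    (hd2.clm_apply (differentiableAt_const _)).hasFDerivAt
  have hDD : ∑ i, DD i = 0 := by
    ext k
    have h0 := aux_lap_zero n Ω hΩ F hF hsym hdiv x hx k
    simp only [PiLp.zero_apply]
    rw [← h0]
    have : (∑ i, DD i) k = ∑ i, (DD i) k := by simp
    rw [this]
    refine Finset.sum_congr rfl fun i _ => ?_
    have h1 := ((EuclideanSpace.proj k : Euc n →L[ℝ] ℝ).hasFDerivAt.comp x (hDd i)).fderiv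
    have h2 : (fun z => fderiv ℝ (fun w => F w k) z (EuclideanSpace.single i 1)) =ᶠ[𝓝 x]
        (EuclideanSpace.proj k : Euc n →L[ℝ] ℝ) ∘ (fun z => fderiv ℝ F z (e i)) := by
      filter_upwards [hΩ.mem_nhds hx] with z hz
      simp [hco z hz, e]
    rw [h2.fderiv_eq, h1]
    simp [DD, e]
  let g : Euc n → ℝ := fun z => ‖F z‖ ^ 2 + ε
  have hgpos : ∀ z, 0 < g z := fun z => by positivity
  have hg : ∀ z ∈ Ω, HasFDerivAt g ((2 : ℝ) • (innerSL ℝ (F z)).comp (fderiv ℝ F z)) z := by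
    intro z hz
    have := (hDz z hz).norm_sq.add_const ε
    refine this.congr_fderiv ?_
    ext w
    simp [two_mul]
  have hpow : ∀ q : ℝ, ∀ z ∈ Ω, HasFDerivAt (fun z => g z ^ q)
      ((q * g z ^ (q - 1)) • ((2 : ℝ) • (innerSL ℝ (F z)).comp (fderiv ℝ F z))) z :=
    fun q z hz => (hg z hz).rpow_const (Or.inl (hgpos z).ne')
  set p := θ / 2 with hp
  have hsecond : ∀ i, fderiv ℝ (fun z => fderiv ℝ (fun z => g z ^ p) z (e i)) x (e i) =
      2 * p * ((p - 1) * g x ^ (p - 2) * 2 * inner ℝ (F x) (T (e i)) ^ 2 +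
        g x ^ (p - 1) * (‖T (e i)‖ ^ 2 + inner ℝ (F x) (DD i))) := by
    intro i
    have h1 : (fun z => fderiv ℝ (fun z => g z ^ p) z (e i)) =ᶠ[𝓝 x]
        fun z => (2 * p) * (g z ^ (p - 1) * inner ℝ (F z) (fderiv ℝ F z (e i))) := by
      filter_upwards [hΩ.mem_nhds hx] with z hz
      rw [(hpow p z hz).fderiv]
      simp
      ring
    have h2 := (((hpow (p - 1) x hx).mul ((hDz x hx).inner ℝ (hDd i))).const_mul (2 * p))
    have h3 : fderiv ℝ (fun z => (2 * p) * (g z ^ (p - 1) * inner ℝ (F z) (fderiv ℝ F z (e i)))) x = _ :=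
      h2.fderiv
    rw [h1.fderiv_eq, h3]
    have h4 : p - 1 - 1 = p - 2 := by ring
    simp [h4, DD, T]
    ring
  have hlap : laplacian (fun z => (‖F z‖ ^ 2 + ε) ^ p) x =
      2 * p * ((p - 1) * g x ^ (p - 2) * 2 * ‖T (F x)‖ ^ 2 +
        g x ^ (p - 1) * ∑ i, ‖T (e i)‖ ^ 2) := by
    unfold laplacian
    have h1 : ∑ i, inner ℝ (F x) (T (e i)) ^ 2 = ‖T (F x)‖ ^ 2 := by
      rw [EuclideanSpace.norm_sq_eq]
      refine Finset.sum_congr rfl fun i _ => ?_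
      have : inner ℝ (F x) (T (e i)) = (T (F x)) i := by
        have := hTs (F x) (e i)
        change inner ℝ (T (F x)) (e i) = inner ℝ (F x) (T (e i)) at this
        rw [← this]
        simp [e, EuclideanSpace.inner_single_right]
      rw [this]; simp
    have h2 : ∑ i, inner ℝ (F x) (DD i) = 0 := by
      rw [← inner_sum, hDD, inner_zero_right]
    calc _ = ∑ i, (2 * p * ((p - 1) * g x ^ (p - 2) * 2 * inner ℝ (F x) (T (e i)) ^ 2 +
        g x ^ (p - 1) * (‖T (e i)‖ ^ 2 + inner ℝ (F x) (DD i)))) :=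
          Finset.sum_congr rfl fun i _ => hsecond i
      _ = _ := by
        rw [← Finset.mul_sum, Finset.sum_add_distrib, ← Finset.mul_sum, ← Finset.mul_sum,
          Finset.sum_add_distrib, h1, h2, add_zero]
  rw [hlap]
  have hgp : g x ^ (p - 1) = g x ^ (p - 2) * g x := by
    rw [← Real.rpow_add_one (hgpos x).ne']
    congr 1; ring
  rw [hgp]
  exact aux_final n (by exact_mod_cast hn) θ hθ0 hθ1 _ _ _ ε _ hε
    (Finset.sum_nonneg fun i _ => by positivity) (by positivity)
    (Real.rpow_pos_of_pos (hgpos x) _).le hmain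

/-- if `F` satisfies the generalized Cauchy–Riemann system on an open set
`Ω ⊆ ℝⁿ`, then `|F|^θ` is subharmonic in `Ω` for every `θ ∈ [(n-2)/(n-1), 1]`. -/
theorem statement8 (n : ℕ) (hn : 2 ≤ n) (Ω : Set (Euc n)) (hΩ : IsOpen Ω)
    (F : Euc n → Euc n) (hF : ContDiffOn ℝ 2 F Ω)
    (hsym : ∀ x ∈ Ω, ∀ j k : Fin n,
      fderiv ℝ (fun z => F z k) x (EuclideanSpace.single j 1) =
        fderiv ℝ (fun z => F z j) x (EuclideanSpace.single k 1))
    (hdiv : ∀ x ∈ Ω,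
      ∑ j : Fin n, fderiv ℝ (fun z => F z j) x (EuclideanSpace.single j 1) = 0)
    (θ : ℝ) (hθ1 : ((n : ℝ) - 2) / ((n : ℝ) - 1) ≤ θ) (hθ2 : θ ≤ 1) :
    ContinuousOn (fun x => ‖F x‖ ^ θ) Ω ∧
    ∀ x ∈ Ω, ∀ r : ℝ, 0 < r → closedBall x r ⊆ Ω →
      ‖F x‖ ^ θ ≤ ⨍ y in ball x r, ‖F y‖ ^ θ := by
  have hn2 : (2 : ℝ) ≤ n := by exact_mod_cast hn
  have hθ0 : 0 ≤ θ := le_trans (div_nonneg (by linarith) (by linarith)) hθ1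
  have hcont : ContinuousOn (fun x => ‖F x‖ ^ θ) Ω :=
    hF.continuousOn.norm.rpow_const fun _ _ => Or.inr hθ0
  refine ⟨hcont, fun x hx r hr hsub => ?_⟩
  have hne : volume (ball x r) ≠ 0 := (measure_ball_pos _ _ hr).ne'
  have hnt : volume (ball x r) ≠ ∞ := measure_ball_lt_top.ne
  rcases hθ0.eq_or_lt with h0 | hpos
  · rw [← h0]
    simp only [Real.rpow_zero]
    rw [setAverage_const hne hnt]
  have hint : IntegrableOn (fun y => ‖F y‖ ^ θ) (ball x r) :=
    ((hcont.mono hsub).integrableOn_compact (isCompact_closedBall x r)).mono_set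
      ball_subset_closedBall
  have hsq : ∀ a : ℝ, 0 ≤ a → (a ^ 2) ^ (θ / 2) = a ^ θ := fun a ha => by
    rw [← Real.rpow_natCast, ← Real.rpow_mul ha]
    congr 1
    push_cast
    ring
  have hstep : ∀ ε : ℝ, 0 < ε → ‖F x‖ ^ θ ≤ (⨍ y in ball x r, ‖F y‖ ^ θ) + ε ^ (θ / 2) := by
    intro ε hε
    have hsm : ContDiffOn ℝ 2 (fun z => (‖F z‖ ^ 2 + ε) ^ (θ / 2)) Ω :=
      ((hF.norm_sq ℝ).add contDiffOn_const).rpow_const_of_ne fun z _ => by positivity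
    have key := aux_submean n (by omega) Ω hΩ _ hsm
      (aux_lap_nonneg n hn Ω hΩ F hF hsym hdiv θ hθ0 hθ1 ε hε) x r hr hsub
    have h1 : ‖F x‖ ^ θ ≤ (‖F x‖ ^ 2 + ε) ^ (θ / 2) := by
      rw [← hsq _ (norm_nonneg _)]
      exact Real.rpow_le_rpow (by positivity) (by linarith) (by linarith)
    refine h1.trans (key.trans ?_)
    have h2 : IntegrableOn (fun y => (‖F y‖ ^ 2 + ε) ^ (θ / 2)) (ball x r) :=
      ((hsm.continuousOn.mono hsub).integrableOn_compact (isCompact_closedBall x r)).mono_set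
        ball_subset_closedBall
    have h3 : IntegrableOn (fun _ : Euc n => ε ^ (θ / 2)) (ball x r) :=
      integrableOn_const hnt
    have h4 : ∫ y in ball x r, (‖F y‖ ^ 2 + ε) ^ (θ / 2) ≤
        ∫ y in ball x r, (‖F y‖ ^ θ + ε ^ (θ / 2)) := by
      refine integral_mono h2 (hint.add h3) fun y => ?_
      change (‖F y‖ ^ 2 + ε) ^ (θ / 2) ≤ ‖F y‖ ^ θ + ε ^ (θ / 2)
      rw [← hsq _ (norm_nonneg (F y))]
      exact Real.rpow_add_le_add_rpow (by positivity) hε.le (by linarith) (by linarith)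
    rw [integral_add hint h3] at h4
    have hV : 0 < volume.real (ball x r) := ENNReal.toReal_pos hne hnt
    rw [setAverage_eq, setAverage_eq, smul_eq_mul, smul_eq_mul]
    rw [setIntegral_const, smul_eq_mul] at h4
    calc _ ≤ (volume.real (ball x r))⁻¹ * (∫ y in ball x r, ‖F y‖ ^ θ +
          0) + ε ^ (θ / 2) := by
            simp only [add_zero]
            rw [inv_mul_le_iff₀ hV, mul_add, mul_inv_cancel_left₀ hV.ne']
            exact h4
      _ = _ := by simp
  have hlim : Tendsto (fun ε : ℝ => (⨍ y in ball x r, ‖F y‖ ^ θ) + ε ^ (θ / 2)) (𝓝[>] 0)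
      (𝓝 ((⨍ y in ball x r, ‖F y‖ ^ θ) + 0 ^ (θ / 2))) := by
    refine Tendsto.mono_left ?_ nhdsWithin_le_nhds
    exact tendsto_const_nhds.add
      ((Real.continuousAt_rpow_const 0 (θ / 2) (Or.inr (by linarith))).tendsto)
  rw [Real.zero_rpow (by linarith), add_zero] at hlim
  exact ge_of_tendsto hlim (by filter_upwards [self_mem_nhdsWithin] with ε hε using hstep ε hε)
end

section
/- Let Ω be an open, nonempty, proper subset of ℝⁿ and for each ε > 0 set O_ε := { x ∈ Ω : dist(x,∂Ω) < ε }. Then there exist a number N > 1 and a family of functions {Φ_ε}_{ε>0} such that for each ε > 0: Φ_ε ∈ C^∞(Ω); the support of Φ_ε is contained in Ω ∖ O_{ε/N}; 0 ≤ Φ_ε ≤ 1 on Ω; Φ_ε ≡ 1 on Ω ∖ O_ε; and for every k ∈ ℕ there is a constant C_k < ∞, independent of ε, such that the k-th order (Fréchet) derivative of Φ_ε satisfies ‖D^k Φ_ε(x)‖ ≤ C_k · ε^{−k} for all x ∈ Ω. -/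
open MeasureTheory Metric Set Filter
open scoped ENNReal NNReal Topology

open scoped Convolution in
theorem conv_bound {n : ℕ} (k : ℕ) : ∀ (F G : Type) [NormedAddCommGroup F] [NormedSpace ℝ F]
    [NormedAddCommGroup G] [NormedSpace ℝ G] (L : F →L[ℝ] ℝ →L[ℝ] G) (f : Euc n → F),
    HasCompactSupport f → ContDiff ℝ (⊤ : ℕ∞) f →
    ∃ C : ℝ, ∀ g : Euc n → ℝ, Measurable g → (∀ x, |g x| ≤ 1) →
      ∀ x, ‖iteratedFDeriv ℝ k (f ⋆[L, volume] g) x‖ ≤ C := by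
  induction k with
  | zero =>
    intro F G _ _ _ _ L f hcf hf
    refine ⟨∫ t, ‖L‖ * ‖f t‖, fun g hg hg1 x => ?_⟩
    rw [norm_iteratedFDeriv_zero]
    unfold convolution
    refine norm_integral_le_of_norm_le
      (((hf.continuous.integrable_of_hasCompactSupport hcf).norm).const_mul _) ?_
    refine Eventually.of_forall fun t => ?_
    refine (L.le_opNorm₂ _ _).trans ?_
    have := hg1 (x - t)
    rw [Real.norm_eq_abs]
    exact mul_le_of_le_one_right (by positivity) this
  | succ k ih =>
    intro F G _ _ _ _ L f hcf hf
    obtain ⟨C, hC⟩ := ih (Euc n →L[ℝ] F) (Euc n →L[ℝ] G) (L.precompL (Euc n)) (fderiv ℝ f)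
      (hcf.fderiv ℝ) (hf.fderiv_right (by simp))
    refine ⟨C, fun g hg hg1 x => ?_⟩
    have hgl : LocallyIntegrable g (volume : Measure (Euc n)) := by
      refine (locallyIntegrable_const (1 : ℝ)).mono hg.aestronglyMeasurable ?_
      refine Eventually.of_forall fun t => ?_
      simpa using hg1 t
    have : fderiv ℝ (f ⋆[L, volume] g) = (fderiv ℝ f ⋆[L.precompL (Euc n), volume] g) := by
      ext1 y
      exact (hcf.hasFDerivAt_convolution_left L (hf.of_le (by exact_mod_cast le_top)) hgl y).fderiv
    rw [← norm_iteratedFDeriv_fderiv, this]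
    exact hC g hg hg1 x

theorem infDist_scale {n : ℕ} (S : Set (Euc n)) {ε : ℝ} (hε : 0 < ε) (x y : Euc n)
    (hy : y ∈ ball (ε⁻¹ • x) (1 / 4)) : |infDist (ε • y) S - infDist x S| < ε / 4 := by
  have h1 : dist (ε • y) x < ε / 4 := by
    have : x = ε • (ε⁻¹ • x) := by rw [smul_smul, mul_inv_cancel₀ hε.ne', one_smul]
    rw [this, dist_smul₀, Real.norm_eq_abs, abs_of_pos hε]
    rw [mem_ball] at hy
    nlinarith
  have h2 := (lipschitz_infDist_pt S).dist_le_mul (ε • y) x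
  rw [Real.dist_eq] at h2
  simp at h2
  linarith

open scoped Convolution in
/-- existence of a family of smooth cutoff functions adapted to the collar
neighborhoods of `∂Ω`, with uniform control of all derivatives. -/
theorem statement10 (n : ℕ) (Ω : Set (Euc n)) (hΩ : IsOpen Ω) (hne : Ω.Nonempty)
    (hprop : Ω ≠ univ) :
    ∃ N : ℝ, 1 < N ∧ ∃ Φ : ℝ → Euc n → ℝ,
      (∀ ε : ℝ, 0 < ε →
        ContDiffOn ℝ (⊤ : ℕ∞) (Φ ε) Ω ∧
        (∀ x ∈ Ω, Φ ε x ≠ 0 → x ∈ Ω \ collar Ω (ε / N)) ∧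
        (∀ x ∈ Ω, 0 ≤ Φ ε x ∧ Φ ε x ≤ 1) ∧
        (∀ x ∈ Ω \ collar Ω ε, Φ ε x = 1)) ∧
      ∀ k : ℕ, ∃ Ck : ℝ, ∀ ε : ℝ, 0 < ε → ∀ x ∈ Ω,
        ‖iteratedFDerivWithin ℝ k (Φ ε) Ω x‖ ≤ Ck * ε⁻¹ ^ k := by
  classical
  let B : ContDiffBump (0 : Euc n) := ⟨1 / 8, 1 / 4, by norm_num, by norm_num⟩
  have hBr : B.rOut = 1 / 4 := rfl
  let φ : Euc n → ℝ := B.normed volume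
  have hφc : HasCompactSupport φ := B.hasCompactSupport_normed
  have hφs : ContDiff ℝ (⊤ : ℕ∞) φ := B.contDiff_normed
  have hφ0 : ∀ t, 0 ≤ φ t := fun t => B.nonneg_normed t
  have hφ1 : ∫ t, φ t = 1 := B.integral_normed
  have hφi : Integrable φ := hφs.continuous.integrable_of_hasCompactSupport hφc
  let A : ℝ → Set (Euc n) := fun ε => {y | ε / 2 < infDist (ε • y) (frontier Ω)}
  let g : ℝ → Euc n → ℝ := fun ε => (A ε).indicator (fun _ => 1)
  have hA : ∀ ε, MeasurableSet (A ε) := fun ε =>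
    (isOpen_lt continuous_const
      ((continuous_infDist_pt _).comp (continuous_const_smul ε))).measurableSet
  have hg : ∀ ε, Measurable (g ε) := fun ε => measurable_const.indicator (hA ε)
  have hg0 : ∀ ε y, 0 ≤ g ε y := fun ε y => indicator_nonneg (fun _ _ => zero_le_one) y
  have hg1 : ∀ ε y, g ε y ≤ 1 := fun ε y => indicator_le_self' (fun _ _ => zero_le_one) y
  have hga : ∀ ε y, |g ε y| ≤ 1 := fun ε y => by rw [abs_of_nonneg (hg0 ε y)]; exact hg1 ε y
  have hgl : ∀ ε, LocallyIntegrable (g ε) (volume : Measure (Euc n)) := fun ε => by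
    refine (locallyIntegrable_const (1 : ℝ)).mono (hg ε).aestronglyMeasurable ?_
    refine Eventually.of_forall fun t => ?_
    simpa using hga ε t
  let L := ContinuousLinearMap.lsmul ℝ ℝ (E := ℝ)
  let Ψ : ℝ → Euc n → ℝ := fun ε => φ ⋆[L, volume] (g ε)
  have hΨ : ∀ ε, ContDiff ℝ (⊤ : ℕ∞) (Ψ ε) := fun ε =>
    hφc.contDiff_convolution_left L hφs (hgl ε)
  refine ⟨4, by norm_num, fun ε x => Ψ ε (ε⁻¹ • x), fun ε hε => ⟨?_, ?_, ?_, ?_⟩, fun k => ?_⟩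
  · exact ((hΨ ε).comp (contDiff_const_smul _)).contDiffOn
  · intro x hx hne
    refine ⟨hx, fun hc => hne ?_⟩
    have hc2 : infDist x (frontier Ω) < ε / 4 := hc.2
    have h0 : ∀ y ∈ ball (ε⁻¹ • x) (1 / 4), g ε y = 0 := fun y hy => by
      refine indicator_of_notMem (s := A ε) (fun h => ?_) _
      have h' : ε / 2 < infDist (ε • y) (frontier Ω) := h
      have := abs_lt.1 (infDist_scale (frontier Ω) hε x y hy)
      linarith [this.2]
    have hx0 := h0 (ε⁻¹ • x) (mem_ball_self (by norm_num))
    exact (B.normed_convolution_eq_right (fun y hy => by rw [h0 y hy, hx0])).trans hx0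
  · intro x _
    constructor
    · exact integral_nonneg fun t => mul_nonneg (hφ0 t) (hg0 _ _)
    · rw [← hφ1]
      refine integral_mono_of_nonneg (Eventually.of_forall fun t => mul_nonneg (hφ0 t) (hg0 _ _))
        hφi (Eventually.of_forall fun t => mul_le_of_le_one_right (hφ0 t) (hg1 _ _))
  · intro x hx
    have hc2 : ε ≤ infDist x (frontier Ω) := by
      by_contra h
      exact hx.2 ⟨hx.1, not_le.1 h⟩
    have h0 : ∀ y ∈ ball (ε⁻¹ • x) (1 / 4), g ε y = 1 := fun y hy => by
      refine indicator_of_mem (s := A ε) ?_ _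
      change ε / 2 < infDist (ε • y) (frontier Ω)
      have := abs_lt.1 (infDist_scale (frontier Ω) hε x y hy)
      linarith [this.1]
    have hx0 := h0 (ε⁻¹ • x) (mem_ball_self (by norm_num))
    exact (B.normed_convolution_eq_right (fun y hy => by rw [h0 y hy, hx0])).trans hx0
  · obtain ⟨C, hC⟩ := conv_bound k ℝ ℝ L φ hφc hφs
    refine ⟨C, fun ε hε x hx => ?_⟩
    rw [iteratedFDerivWithin_of_isOpen k hΩ hx,
      iteratedFDeriv_comp_const_smul _ ((hΨ ε).of_le (by exact_mod_cast le_top)), norm_smul,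
      norm_pow, Real.norm_eq_abs, abs_of_pos (inv_pos.2 hε), mul_comm]
    exact mul_le_mul_of_nonneg_right (hC (g ε) (hg ε) (hga ε) _) (by positivity)
end
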